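/- arXiv:1012.4096 — 4 statements merged into one kernel-verified Lean document; each statement's English description precedes it below -/
import Mathlib

section
/- Let n ≥ 2 and m ≥ 1, let f : ℝⁿ → ℝᵐ be a C^∞ function with f(0) = 0 and Df(0) = 0, and let φ : ℝⁿ → ℝ be a C^∞ compactly supported function. For Re s > -n define B(s) = ∫_{ℝⁿ} (‖w‖² + ‖f(w)‖²)^{s/2} φ(w) dw. Then there exists a function F : ℂ → ℂ such that: (i) F(s) = B(s) for all s with Re s > -n; (ii) F is complex differentiable at every point of ℂ \ {−n − 2k : k ∈ ℕ, k ≥ 0}; and (iii) for each k ∈ ℕ, the function s ↦ (s − (−n − 2k)) · F(s) extends to a function complex differentiable at −n − 2k (i.e. F has at worst a simple pole at each point −n − 2k). -/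
open MeasureTheory Complex

theorem bry_paramInt_hasFDerivAt {E G : Type} [NormedAddCommGroup E] [NormedSpace ℝ E]
    [FiniteDimensional ℝ E] [NormedAddCommGroup G] [NormedSpace ℝ G] [CompleteSpace G]
    (h : E × ℝ → G) (hh : ContDiff ℝ (⊤ : ℕ∞) h) (x₀ : E) :
    HasFDerivAt (fun x => ∫ t in (0:ℝ)..1, h (x, t))
      (∫ t in (0:ℝ)..1, (fderiv ℝ h (x₀, t)).comp (ContinuousLinearMap.inl ℝ E ℝ)) x₀ := by
  have hc : Continuous h := hh.continuous
  have hd : Continuous (fun p : E × ℝ => (fderiv ℝ h p).comp (ContinuousLinearMap.inl ℝ E ℝ)) :=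
    (hh.continuous_fderiv (by simp)).clm_comp continuous_const
  obtain ⟨C, hC⟩ := ((isCompact_closedBall x₀ (1:ℝ)).prod (isCompact_Icc (a := (0:ℝ)) (b := 1))).exists_bound_of_continuousOn hd.continuousOn
  refine intervalIntegral.hasFDerivAt_integral_of_dominated_of_fderiv_le
    (F' := fun x t => (fderiv ℝ h (x, t)).comp (ContinuousLinearMap.inl ℝ E ℝ))
    (bound := fun _ => C) (Metric.closedBall_mem_nhds x₀ one_pos) ?_ ?_ ?_ ?_ ?_ ?_
  · exact Filter.Eventually.of_forall fun x =>
      (hc.comp (Continuous.prodMk_right x)).aestronglyMeasurable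
  · exact (hc.comp (Continuous.prodMk_right x₀)).intervalIntegrable _ _
  · exact (hd.comp (Continuous.prodMk_right x₀)).aestronglyMeasurable
  · refine Filter.Eventually.of_forall fun t ht x hx => hC (x, t) ⟨hx, ?_⟩
    rw [Set.uIoc_of_le zero_le_one] at ht
    exact ⟨ht.1.le, ht.2⟩
  · simp
  · refine Filter.Eventually.of_forall fun t ht x hx => ?_
    have h1 : HasFDerivAt h (fderiv ℝ h (x, t)) (x, t) :=
      (hh.differentiable (by simp) (x, t)).hasFDerivAt
    have h2 : HasFDerivAt (fun x : E => (x, t)) (ContinuousLinearMap.inl ℝ E ℝ) x :=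
      hasFDerivAt_prodMk_left x t
    exact h1.comp x h2

theorem bry_paramInt_contDiff_nat {E : Type} [NormedAddCommGroup E] [NormedSpace ℝ E]
    [FiniteDimensional ℝ E] (N : ℕ) : ∀ {G : Type} [NormedAddCommGroup G] [NormedSpace ℝ G]
    [CompleteSpace G] (h : E × ℝ → G) (_ : ContDiff ℝ (⊤ : ℕ∞) h),
    ContDiff ℝ N (fun x => ∫ t in (0:ℝ)..1, h (x, t)) := by
  induction N with
  | zero =>
    intro G _ _ _ h hh
    have : Differentiable ℝ (fun x => ∫ t in (0:ℝ)..1, h (x, t)) :=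
      fun x => (bry_paramInt_hasFDerivAt h hh x).differentiableAt
    exact contDiff_zero.2 this.continuous
  | succ N ih =>
    intro G _ _ _ h hh
    have := (contDiff_succ_iff_hasFDerivAt (𝕜 := ℝ) (n := N)
      (f := fun x => ∫ t in (0:ℝ)..1, h (x, t))).2
      ⟨_, ih (fun p : E × ℝ => (fderiv ℝ h p).comp (ContinuousLinearMap.inl ℝ E ℝ))
        ((hh.fderiv_right (by simp)).clm_comp contDiff_const),
        fun x => bry_paramInt_hasFDerivAt h hh x⟩
    exact_mod_cast this

theorem bry_paramInt_contDiff {E G : Type} [NormedAddCommGroup E] [NormedSpace ℝ E]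
    [FiniteDimensional ℝ E] [NormedAddCommGroup G] [NormedSpace ℝ G] [CompleteSpace G]
    (h : E × ℝ → G) (hh : ContDiff ℝ (⊤ : ℕ∞) h) :
    ContDiff ℝ (⊤ : ℕ∞) (fun x => ∫ t in (0:ℝ)..1, h (x, t)) :=
  contDiff_infty.2 fun N => bry_paramInt_contDiff_nat N h hh

/-- Hadamard's lemma along rays. -/
theorem bry_hadamard {E G : Type} [NormedAddCommGroup E] [NormedSpace ℝ E]
    [FiniteDimensional ℝ E] [NormedAddCommGroup G] [NormedSpace ℝ G] [CompleteSpace G]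
    (f : E → G) (hf : ContDiff ℝ (⊤ : ℕ∞) f) (hf0 : f 0 = 0) :
    ∃ g : ℝ × E → G, ContDiff ℝ (⊤ : ℕ∞) g ∧ (∀ r θ, f (r • θ) = r • g (r, θ)) ∧
      (∀ r θ, g (-r, -θ) = - g (r, θ)) := by
  refine ⟨fun p => ∫ t in (0:ℝ)..1, fderiv ℝ f (t • p.1 • p.2) p.2, ?_, ?_, ?_⟩
  · refine bry_paramInt_contDiff (fun q : (ℝ × E) × ℝ => fderiv ℝ f (q.2 • q.1.1 • q.1.2) q.1.2) ?_
    have h1 : ContDiff ℝ (⊤ : ℕ∞) (fderiv ℝ f) := hf.fderiv_right (by simp)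
    have h2 : ContDiff ℝ (⊤ : ℕ∞) (fun q : (ℝ × E) × ℝ => q.2 • q.1.1 • q.1.2) := by fun_prop
    exact (h1.comp h2).clm_apply (by fun_prop)
  · intro r θ
    have hd : ∀ t : ℝ, HasDerivAt (fun t : ℝ => f (t • r • θ)) (r • fderiv ℝ f (t • r • θ) θ) t := by
      intro t
      have h1 := (hf.differentiable (by simp) (t • r • θ)).hasFDerivAt
      have h2 : HasDerivAt (fun t : ℝ => t • r • θ) (r • θ) t := by
        simpa using (hasDerivAt_id t).smul_const (r • θ)
      simpa [Function.comp_def] using h1.comp_hasDerivAt t h2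
    have := intervalIntegral.integral_eq_sub_of_hasDerivAt (a := 0) (b := 1) (fun t _ => hd t) ?_
    · simp only [one_smul, zero_smul, hf0, sub_zero] at this
      rw [← this, intervalIntegral.integral_smul]
    · apply Continuous.intervalIntegrable
      have h1 : Continuous (fderiv ℝ f) := hf.continuous_fderiv (by simp)
      exact ((h1.comp (by fun_prop)).clm_apply continuous_const).const_smul r
  · intro r θ
    simp

/-- The integrand in polar coordinates. -/
noncomputable def bryK {V : Type} [NormedAddCommGroup V] (L c : ℝ × V → ℝ) (a : ℕ) (s : ℂ)
    (x : Metric.sphere (0 : V) 1 × ℝ) : ℂ :=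
  (x.2 : ℂ) ^ (s + a - 1) * (exp (s * (L (x.2, x.1) : ℂ)) * (c (x.2, x.1) : ℂ))

theorem bry_rpow_bound {r R x δ M : ℝ} (hr : 0 < r) (hrR : r ≤ R) (hR : 1 ≤ R)
    (hδ : 0 < δ) (h1 : δ ≤ x) (h2 : x ≤ M) : r ^ (x - 1) ≤ R ^ M * r ^ (δ - 1) := by
  have e : x - 1 = (x - δ) + (δ - 1) := by ring
  rw [e, Real.rpow_add hr]
  gcongr
  calc r ^ (x - δ) ≤ R ^ (x - δ) := Real.rpow_le_rpow hr.le hrR (by linarith)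
    _ ≤ R ^ M := Real.rpow_le_rpow_of_exponent_le hR (by linarith)

theorem bry_log_bound {r R x δ M : ℝ} (hr : 0 < r) (hrR : r ≤ R) (hR : 1 ≤ R)
    (hδ : 0 < δ) (h1 : 2 * δ ≤ x) (h2 : x ≤ M) :
    |Real.log r| * r ^ (x - 1) ≤ (2 * R ^ (M + δ) / δ) * r ^ (δ - 1) := by
  have hl : |Real.log r| ≤ r ^ δ / δ + r ^ (-δ) / δ := by
    have p1 : 0 < r ^ δ / δ := by positivity
    have p2 : 0 < r ^ (-δ) / δ := by positivity
    rw [abs_le]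
    constructor
    · have := Real.log_le_rpow_div (x := r⁻¹) (by positivity) hδ
      rw [Real.log_inv, Real.inv_rpow hr.le, ← Real.rpow_neg hr.le] at this
      linarith
    · have := Real.log_le_rpow_div (x := r) hr.le hδ
      linarith
  have b1 := bry_rpow_bound (x := x + δ) (M := M + δ) hr hrR hR hδ (by linarith) (by linarith)
  have b2 := bry_rpow_bound (x := x - δ) (M := M + δ) hr hrR hR hδ (by linarith) (by linarith)
  calc |Real.log r| * r ^ (x - 1) ≤ (r ^ δ / δ + r ^ (-δ) / δ) * r ^ (x - 1) := by gcongr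
    _ = (r ^ (x + δ - 1) + r ^ (x - δ - 1)) / δ := by
      have e1 : x + δ - 1 = δ + (x - 1) := by ring
      have e2 : x - δ - 1 = -δ + (x - 1) := by ring
      rw [e1, e2, Real.rpow_add hr, Real.rpow_add hr]; ring
    _ ≤ (R ^ (M + δ) * r ^ (δ - 1) + R ^ (M + δ) * r ^ (δ - 1)) / δ := by gcongr
    _ = _ := by ring

set_option linter.unusedSectionVars false
section
variable {V : Type} [NormedAddCommGroup V] [NormedSpace ℝ V] [FiniteDimensional ℝ V]
  [MeasurableSpace V] [BorelSpace V] (σ : Measure (Metric.sphere (0 : V) 1)) [IsFiniteMeasure σ]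

/-- The measure `σ × dr` on `sphere × (0, R]`. -/
noncomputable def bryM (σ : Measure (Metric.sphere (0 : V) 1)) (R : ℝ) :
    Measure (Metric.sphere (0 : V) 1 × ℝ) :=
  σ.prod (volume.restrict (Set.Ioc 0 R))

theorem bry_ae_mem [SecondCountableTopology V] (R : ℝ) :
    ∀ᵐ x ∂(bryM σ R), x.2 ∈ Set.Ioc 0 R := by
  have h : ∀ᵐ r ∂(volume.restrict (Set.Ioc 0 R)), r ∈ Set.Ioc 0 R :=
    ae_restrict_mem measurableSet_Ioc
  exact Measure.quasiMeasurePreserving_snd.ae h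

theorem bry_integrable_rpow (R δ : ℝ) (hR : 0 ≤ R) (hδ : 0 < δ) :
    Integrable (fun x : Metric.sphere (0 : V) 1 × ℝ => x.2 ^ (δ - 1)) (bryM σ R) := by
  have h : Integrable (fun r : ℝ => r ^ (δ - 1)) (volume.restrict (Set.Ioc 0 R)) :=
    (intervalIntegrable_iff_integrableOn_Ioc_of_le hR).1
      (intervalIntegral.intervalIntegrable_rpow' (by linarith))
  exact h.comp_snd σ

theorem bry_measurable (L c : ℝ × V → ℝ) (hL : Continuous L) (hc : Continuous c) (a : ℕ) (s : ℂ) :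
    Measurable (bryK L c a s) := by
  have : SecondCountableTopology V := by
    have := FiniteDimensional.proper_real V
    infer_instance
  have hcont : Continuous (fun x : Metric.sphere (0 : V) 1 × ℝ =>
      exp (s * (L (x.2, x.1) : ℂ)) * (c (x.2, x.1) : ℂ)) := by fun_prop
  unfold bryK
  exact (Measurable.pow_const (by fun_prop) _).mul hcont.measurable

theorem bry_exists_bound [ProperSpace V] (c : ℝ × V → ℝ) (hc : Continuous c) (R : ℝ) :
    ∃ A, 0 ≤ A ∧ ∀ x : Metric.sphere (0 : V) 1 × ℝ, x.2 ∈ Set.Ioc 0 R → |c (x.2, x.1)| ≤ A := by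
  obtain ⟨C, hC⟩ := ((isCompact_Icc (a := (0:ℝ)) (b := R)).prod
    (isCompact_sphere (0 : V) 1)).exists_bound_of_continuousOn hc.continuousOn
  refine ⟨max C 0, le_max_right _ _, fun x hx => ?_⟩
  exact (hC (x.2, x.1) ⟨⟨hx.1.le, hx.2⟩, x.1.2⟩).trans (le_max_left _ _)

theorem bry_norm_le (L c : ℝ × V → ℝ) (a : ℕ) (s : ℂ) {A B : ℝ}
    (x : Metric.sphere (0 : V) 1 × ℝ) (hx : 0 < x.2) (hA : |L (x.2, x.1)| ≤ A)
    (hB : |c (x.2, x.1)| ≤ B) :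
    ‖bryK L c a s x‖ ≤ x.2 ^ (s.re + a - 1) * (Real.exp (‖s‖ * A) * B) := by
  unfold bryK
  rw [norm_mul, norm_mul, Complex.norm_cpow_eq_rpow_re_of_pos hx, Complex.norm_exp]
  have e : (s + a - 1).re = s.re + a - 1 := by simp
  rw [e, Complex.norm_real, Real.norm_eq_abs]
  gcongr
  calc (s * (L (x.2, x.1) : ℂ)).re ≤ ‖s * (L (x.2, x.1) : ℂ)‖ := Complex.re_le_norm _
    _ = ‖s‖ * |L (x.2, x.1)| := by rw [norm_mul, Complex.norm_real, Real.norm_eq_abs]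
    _ ≤ _ := by gcongr

theorem bry_integrable (L c : ℝ × V → ℝ) (hL : Continuous L) (hc : Continuous c) (a : ℕ) (s : ℂ)
    (R : ℝ) (hR : 1 ≤ R) (hs : -(a : ℝ) < s.re) : Integrable (bryK L c a s) (bryM σ R) := by
  have := FiniteDimensional.proper_real V
  obtain ⟨A, hA0, hA⟩ := bry_exists_bound L hL R
  obtain ⟨B, hB0, hB⟩ := bry_exists_bound c hc R
  refine Integrable.mono' ((bry_integrable_rpow σ R (s.re + a) (by linarith)
    (by linarith)).mul_const (Real.exp (‖s‖ * A) * B))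
    (bry_measurable L c hL hc a s).aestronglyMeasurable ?_
  filter_upwards [bry_ae_mem σ R] with x hx
  exact bry_norm_le L c a s x hx.1 (hA x hx) (hB x hx)

theorem bry_differentiableAt (L c : ℝ × V → ℝ) (hL : Continuous L) (hc : Continuous c) (a : ℕ)
    (s₀ : ℂ) (R : ℝ) (hR : 1 ≤ R) (hs : -(a : ℝ) < s₀.re) :
    DifferentiableAt ℂ (fun s => ∫ x, bryK L c a s x ∂(bryM σ R)) s₀ := by
  have := FiniteDimensional.proper_real V
  obtain ⟨A, hA0, hA⟩ := bry_exists_bound L hL R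
  obtain ⟨B, hB0, hB⟩ := bry_exists_bound c hc R
  set δ : ℝ := (s₀.re + a) / 3 with hδdef
  have hδ : 0 < δ := by simp only [hδdef]; linarith
  set M : ℝ := s₀.re + a + δ
  set T : ℝ := ‖s₀‖ + δ
  have hT : 0 ≤ T := by positivity
  let K' : ℂ → Metric.sphere (0 : V) 1 × ℝ → ℂ := fun s x =>
    ((Real.log x.2 : ℂ) + (L (x.2, x.1) : ℂ)) * bryK L c a s x
  have key := hasDerivAt_integral_of_dominated_loc_of_deriv_le (μ := bryM σ R)
    (F := fun s x => bryK L c a s x) (F' := K') (x₀ := s₀)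
    (bound := fun x => (2 * R ^ (M + δ) / δ + A * R ^ M) * (Real.exp (T * A) * B) * x.2 ^ (δ - 1))
    (s := Metric.ball s₀ δ) (Metric.ball_mem_nhds s₀ hδ) ?_ ?_ ?_ ?_ ?_ ?_
  · exact key.2.differentiableAt
  · exact Filter.Eventually.of_forall fun s => (bry_measurable L c hL hc a s).aestronglyMeasurable
  · exact bry_integrable σ L c hL hc a s₀ R hR hs
  · have : SecondCountableTopology V := inferInstance
    have hLm : Measurable (fun x : Metric.sphere (0 : V) 1 × ℝ => (L (x.2, x.1) : ℂ)) :=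
      Continuous.measurable (by fun_prop)
    exact (Measurable.mul (by fun_prop) (bry_measurable L c hL hc a s₀)).aestronglyMeasurable
  · filter_upwards [bry_ae_mem σ R] with x hx s hsb
    have hn := bry_norm_le L c a s x hx.1 (hA x hx) (hB x hx)
    have hd : ‖s - s₀‖ < δ := by simpa [dist_eq_norm] using hsb
    have hre : |s.re - s₀.re| < δ := by
      have := Complex.abs_re_le_norm (s - s₀)
      simp only [sub_re] at this
      linarith
    rw [abs_lt] at hre
    have hsT : ‖s‖ ≤ T := by
      have : ‖s‖ ≤ ‖s₀‖ + ‖s - s₀‖ := by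
        simpa using norm_add_le s₀ (s - s₀)
      simp only [T]; linarith
    have h1 : 2 * δ ≤ s.re + a := by simp only [hδdef] at hre ⊢; linarith
    have h2 : s.re + a ≤ M := by simp only [M]; linarith
    have b1 := bry_log_bound hx.1 hx.2 hR hδ h1 h2
    have b2 := bry_rpow_bound hx.1 hx.2 hR hδ (by linarith : δ ≤ s.re + a) h2
    have hx1 : 0 < x.2 := hx.1
    have hle : ‖(Real.log x.2 : ℂ) + (L (x.2, x.1) : ℂ)‖ ≤ |Real.log x.2| + A := by
      refine (norm_add_le _ _).trans ?_
      rw [Complex.norm_real, Complex.norm_real, Real.norm_eq_abs, Real.norm_eq_abs]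
      have := hA x hx
      linarith
    calc ‖K' s x‖ = ‖(Real.log x.2 : ℂ) + (L (x.2, x.1) : ℂ)‖ * ‖bryK L c a s x‖ := norm_mul _ _
      _ ≤ (|Real.log x.2| + A) * (x.2 ^ (s.re + a - 1) * (Real.exp (T * A) * B)) := by
        gcongr
        refine hn.trans ?_
        gcongr
      _ = (|Real.log x.2| * x.2 ^ (s.re + a - 1) + A * x.2 ^ (s.re + a - 1)) *
          (Real.exp (T * A) * B) := by ring
      _ ≤ ((2 * R ^ (M + δ) / δ) * x.2 ^ (δ - 1) + A * (R ^ M * x.2 ^ (δ - 1))) *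
          (Real.exp (T * A) * B) := by gcongr
      _ = _ := by ring
  · exact (bry_integrable_rpow σ R δ (by linarith) hδ).const_mul _
  · filter_upwards [bry_ae_mem σ R] with x hx s hsb
    have hx0 : (x.2 : ℂ) ≠ 0 := by exact_mod_cast hx.1.ne'
    have h1 : HasDerivAt (fun s : ℂ => (x.2 : ℂ) ^ (s + a - 1))
        ((x.2 : ℂ) ^ (s + a - 1) * Complex.log x.2 * 1) s := by
      refine HasDerivAt.const_cpow ?_ (Or.inl hx0)
      exact ((hasDerivAt_id s).add_const _).sub_const _
    have h2 : HasDerivAt (fun s : ℂ => exp (s * (L (x.2, x.1) : ℂ)))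
        (exp (s * (L (x.2, x.1) : ℂ)) * (1 * (L (x.2, x.1) : ℂ))) s :=
      ((hasDerivAt_id s).mul_const _).cexp
    have h3 := h1.mul (h2.mul_const (c (x.2, x.1) : ℂ))
    refine HasDerivAt.congr_deriv (f := fun s => bryK L c a s x) h3 ?_
    simp only [K', bryK, Complex.ofReal_log hx.1.le]
    ring
end

section
variable {V : Type} [NormedAddCommGroup V] [NormedSpace ℝ V] [FiniteDimensional ℝ V]
  [MeasurableSpace V] [BorelSpace V] (σ : Measure (Metric.sphere (0 : V) 1)) [IsFiniteMeasure σ]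

/-- The radial derivative. -/
noncomputable def bryD (c : ℝ × V → ℝ) (p : ℝ × V) : ℝ := fderiv ℝ c p (1, 0)

theorem bryD_contDiff (c : ℝ × V → ℝ) (hc : ContDiff ℝ (⊤ : ℕ∞) c) :
    ContDiff ℝ (⊤ : ℕ∞) (bryD c) :=
  (hc.fderiv_right (m := (⊤ : ℕ∞)) (by simp)).clm_apply contDiff_const

theorem bryD_hasDerivAt (c : ℝ × V → ℝ) (hc : ContDiff ℝ (⊤ : ℕ∞) c) (r : ℝ) (θ : V) :
    HasDerivAt (fun r => c (r, θ)) (bryD c (r, θ)) r := by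
  have h1 := (hc.differentiable (by simp) (r, θ)).hasFDerivAt
  have h2 : HasDerivAt (fun r : ℝ => (r, θ)) ((1 : ℝ), (0 : V)) r :=
    (hasDerivAt_id r).prodMk (hasDerivAt_const r θ)
  exact h1.comp_hasDerivAt r h2

theorem bryD_parity (c : ℝ × V → ℝ) (hc : ContDiff ℝ (⊤ : ℕ∞) c) (ε : ℝ)
    (h : ∀ r θ, c (-r, -θ) = ε * c (r, θ)) (r : ℝ) (θ : V) :
    bryD c (-r, -θ) = -ε * bryD c (r, θ) := by
  have h1 : HasDerivAt (fun r => c (-r, -θ)) (bryD c (-r, -θ) * (-1)) r :=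
    (bryD_hasDerivAt c hc (-r) (-θ)).comp r (hasDerivAt_neg r)
  have h2 : HasDerivAt (fun r => c (-r, -θ)) (ε * bryD c (r, θ)) r := by
    simp only [h]
    exact (bryD_hasDerivAt c hc r θ).const_mul ε
  have := h1.unique h2
  linarith

theorem bryD_zero (c : ℝ × V → ℝ) (hc : ContDiff ℝ (⊤ : ℕ∞) c) (R : ℝ) (θ : V)
    (h : ∀ r, R < r → c (r, θ) = 0) (r : ℝ) (hr : R < r) : bryD c (r, θ) = 0 := by
  have h1 := bryD_hasDerivAt c hc r θ
  have h2 : HasDerivAt (fun r => c (r, θ)) 0 r := by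
    refine (hasDerivAt_const r (0:ℝ)).congr_of_eventuallyEq ?_
    filter_upwards [lt_mem_nhds hr] with y hy using h y hy
  exact h1.unique h2

theorem bry_radial_deriv (L c : ℝ × V → ℝ) (hL : ContDiff ℝ (⊤ : ℕ∞) L)
    (hc : ContDiff ℝ (⊤ : ℕ∞) c) (s : ℂ) (r : ℝ) (θ : V) :
    HasDerivAt (fun r : ℝ => exp (s * (L (r, θ) : ℂ)) * (c (r, θ) : ℂ))
      (s * (exp (s * (L (r, θ) : ℂ)) * ((bryD L (r, θ) * c (r, θ) : ℝ) : ℂ)) +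
        exp (s * (L (r, θ) : ℂ)) * (bryD c (r, θ) : ℂ)) r := by
  have h1 := (bryD_hasDerivAt L hL r θ).ofReal_comp
  have h2 := (bryD_hasDerivAt c hc r θ).ofReal_comp
  refine ((h1.const_mul s).cexp.mul h2).congr_deriv ?_
  push_cast
  ring

theorem bry_ibp (L c : ℝ × V → ℝ) (hL : ContDiff ℝ (⊤ : ℕ∞) L)
    (hc : ContDiff ℝ (⊤ : ℕ∞) c) (a : ℕ) (s : ℂ) (R : ℝ) (hR : 1 ≤ R)
    (hs : -(a : ℝ) < s.re) (hcR : ∀ θ : Metric.sphere (0 : V) 1, c (R, θ) = 0) :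
    s * (∫ x, bryK L (fun p => bryD L p * c p) (a + 1) s x ∂(bryM σ R)) +
      (∫ x, bryK L (bryD c) (a + 1) s x ∂(bryM σ R)) =
    -(s + a) * ∫ x, bryK L c a s x ∂(bryM σ R) := by
  have hs' : -((a + 1 : ℕ) : ℝ) < s.re := by push_cast; linarith
  have i1 := bry_integrable σ L (fun p => bryD L p * c p) hL.continuous
    ((bryD_contDiff L hL).continuous.mul hc.continuous) (a + 1) s R hR hs'
  have i2 := bry_integrable σ L (bryD c) hL.continuous
    (bryD_contDiff c hc).continuous (a + 1) s R hR hs'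
  have i3 := bry_integrable σ L c hL.continuous hc.continuous a s R hR hs
  have i12 : Integrable (fun x => s * bryK L (fun p => bryD L p * c p) (a + 1) s x + bryK L (bryD c) (a + 1) s x) (bryM σ R) :=
    (i1.const_mul s).add i2
  have itot : Integrable (fun x => (s * bryK L (fun p => bryD L p * c p) (a + 1) s x + bryK L (bryD c) (a + 1) s x) +
      (s + a) * bryK L c a s x) (bryM σ R) := i12.add (i3.const_mul (s + a))
  have hz : ∫ x, ((s * bryK L (fun p => bryD L p * c p) (a + 1) s x +
      bryK L (bryD c) (a + 1) s x) + (s + a) * bryK L c a s x) ∂(bryM σ R) = 0 := by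
    unfold bryM at itot ⊢
    rw [integral_prod _ itot]
    rw [integral_eq_zero_of_ae]
    filter_upwards [itot.prod_right_ae] with θ hθ
    rw [← intervalIntegral.integral_of_le (by linarith)]
    have hint : IntervalIntegrable (fun r : ℝ => (s * bryK L (fun p => bryD L p * c p) (a + 1) s (θ, r) +
      bryK L (bryD c) (a + 1) s (θ, r)) + (s + a) * bryK L c a s (θ, r)) volume 0 R :=
      (intervalIntegrable_iff_integrableOn_Ioc_of_le (by linarith)).2 hθ
    have hsa : 0 < (s + a).re := by simp; linarith
    have hcont : Continuous (fun r : ℝ => (r : ℂ) ^ (s + a) *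
        (exp (s * (L (r, θ) : ℂ)) * (c (r, θ) : ℂ))) := by
      have h1 : Continuous (fun r : ℝ => (r : ℂ) ^ (s + a)) :=
        continuous_ofReal_cpow_const hsa
      have h2 := hL.continuous
      have h3 := hc.continuous
      fun_prop
    rw [intervalIntegral.integral_eq_sub_of_hasDerivAt_of_le (by linarith) hcont.continuousOn
      (fun r hr => ?_) hint]
    · have : s + a ≠ 0 := fun h => by simp [h] at hsa
      simp [hcR θ, Complex.zero_cpow this]
    · have hr0 : (r : ℂ) ≠ 0 := by exact_mod_cast hr.1.ne'
      have h1 : HasDerivAt (fun r : ℝ => (r : ℂ) ^ (s + a)) ((s + a) * (r : ℂ) ^ (s + a - 1)) r := by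
        have hsl : (r : ℂ) ∈ slitPlane := Or.inl (by simpa using hr.1)
        have := (Complex.hasStrictDerivAt_cpow_const (c := s + a) hsl).hasDerivAt
        exact this.comp_ofReal
      refine (h1.mul (bry_radial_deriv L c hL hc s r θ)).congr_deriv ?_
      simp only [bryK]
      have e : s + ((a + 1 : ℕ) : ℂ) - 1 = s + a := by push_cast; ring
      rw [e]
      push_cast
      ring
  rw [integral_add i12 (i3.const_mul (s + a)),
    integral_add (i1.const_mul s) i2, integral_const_mul, integral_const_mul] at hz
  linear_combination hz

theorem bry_odd_zero (hσ : ∀ o : Metric.sphere (0 : V) 1 → ℂ, (∀ θ, o (-θ) = - o θ) → ∫ θ, o θ ∂σ = 0)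
    (L c : ℝ × V → ℝ) (hL : ContDiff ℝ (⊤ : ℕ∞) L)
    (hc : ContDiff ℝ (⊤ : ℕ∞) c) (a : ℕ) (R : ℝ) (hR : 1 ≤ R)
    (hcR : ∀ θ : Metric.sphere (0 : V) 1, c (R, θ) = 0)
    (hLe : ∀ r θ, L (-r, -θ) = L (r, θ)) (hco : ∀ r θ, c (-r, -θ) = - c (r, θ)) :
    (-(a : ℂ)) * (∫ x, bryK L (fun p => bryD L p * c p) (a + 1) (-(a : ℂ)) x ∂(bryM σ R)) +
      (∫ x, bryK L (bryD c) (a + 1) (-(a : ℂ)) x ∂(bryM σ R)) = 0 := by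
  set s : ℂ := -(a : ℂ) with hsdef
  have hs' : -((a + 1 : ℕ) : ℝ) < s.re := by simp [hsdef]
  have i1 := bry_integrable σ L (fun p => bryD L p * c p) hL.continuous
    ((bryD_contDiff L hL).continuous.mul hc.continuous) (a + 1) s R hR hs'
  have i2 := bry_integrable σ L (bryD c) hL.continuous
    (bryD_contDiff c hc).continuous (a + 1) s R hR hs'
  have itot : Integrable (fun x => s * bryK L (fun p => bryD L p * c p) (a + 1) s x + bryK L (bryD c) (a + 1) s x) (bryM σ R) :=
    (i1.const_mul s).add i2
  rw [← integral_const_mul, ← integral_add (i1.const_mul s) i2]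
  unfold bryM at itot ⊢
  rw [integral_prod _ itot]
  refine Eq.trans (integral_congr_ae (g := fun θ : Metric.sphere (0 : V) 1 =>
    -(exp (s * (L (0, θ) : ℂ)) * (c (0, θ) : ℂ))) ?_) ?_
  · filter_upwards [itot.prod_right_ae] with θ hθ
    rw [← intervalIntegral.integral_of_le (by linarith)]
    have hint : IntervalIntegrable (fun r : ℝ => (s * bryK L (fun p => bryD L p * c p) (a + 1) s (θ, r) +
      bryK L (bryD c) (a + 1) s (θ, r))) volume 0 R :=
      (intervalIntegrable_iff_integrableOn_Ioc_of_le (by linarith)).2 hθ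
    have hcont : Continuous (fun r : ℝ =>
        (exp (s * (L (r, θ) : ℂ)) * (c (r, θ) : ℂ))) := by
      have h2 := hL.continuous
      have h3 := hc.continuous
      fun_prop
    rw [intervalIntegral.integral_eq_sub_of_hasDerivAt_of_le (by linarith) hcont.continuousOn
      (fun r hr => ?_) hint]
    · simp [hcR θ]
    · refine (bry_radial_deriv L c hL hc s r θ).congr_deriv ?_
      simp only [bryK]
      have e : s + ((a + 1 : ℕ) : ℂ) - 1 = 0 := by simp [hsdef]
      rw [e, Complex.cpow_zero]
      push_cast
      ring
  · refine hσ _ fun θ => ?_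
    have h1 := hLe 0 θ
    have h2 := hco 0 θ
    rw [neg_zero] at h1 h2
    simp [h1, h2]
end

open scoped Pointwise in
theorem bry_toSphere_odd {V : Type} [NormedAddCommGroup V] [NormedSpace ℝ V] [FiniteDimensional ℝ V]
    [MeasurableSpace V] [BorelSpace V] (μ : Measure V) [μ.IsAddHaarMeasure]
    (o : Metric.sphere (0 : V) 1 → ℂ) (ho : ∀ θ, o (-θ) = - o θ) :
    ∫ θ, o θ ∂μ.toSphere = 0 := by
  have hmap : μ.toSphere.map (Homeomorph.neg (Metric.sphere (0 : V) 1)) = μ.toSphere := by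
    ext t ht
    rw [Measure.map_apply (Homeomorph.measurable _) ht, Measure.toSphere_apply' _ ht,
      Measure.toSphere_apply' _ ((Homeomorph.measurable _) ht)]
    congr 1
    rw [← Measure.measure_neg μ (Set.Ioo (0:ℝ) 1 • (Set.image Subtype.val t))]
    congr 1
    rw [← Set.smul_neg]
    congr 1
    ext v
    simp only [Set.mem_image, Set.mem_preimage, Set.mem_neg, Homeomorph.coe_neg]
    constructor
    · rintro ⟨x, hx, rfl⟩
      exact ⟨-x, hx, rfl⟩
    · rintro ⟨x, hx, h⟩
      exact ⟨-x, by simpa using hx, by simp [h]⟩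
  have h := (Homeomorph.neg (Metric.sphere (0 : V) 1)).measurableEmbedding.integral_map
    (μ := μ.toSphere) o
  rw [hmap] at h
  simp only [Homeomorph.coe_neg, ho, integral_neg] at h
  exact self_eq_neg.mp h

theorem bry_polar {V : Type} [NormedAddCommGroup V] [NormedSpace ℝ V] [FiniteDimensional ℝ V]
    [MeasurableSpace V] [BorelSpace V] [Nontrivial V] (μ : Measure V) [μ.IsAddHaarMeasure]
    (h : V → ℂ) :
    ∫ w, h w ∂μ = ∫ x : Metric.sphere (0 : V) 1 × ℝ,
      ((x.2 ^ (Module.finrank ℝ V - 1) : ℝ) : ℂ) * h (x.2 • (x.1 : V))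
        ∂(μ.toSphere.prod (volume.restrict (Set.Ioi 0))) := by
  have : SecondCountableTopology V := by
    have := FiniteDimensional.proper_real V
    infer_instance
  have hsf : SFinite ((volume : Measure ℝ).comap (Subtype.val : Set.Ioi (0:ℝ) → ℝ)) :=
    have hsig : SigmaFinite ((volume : Measure ℝ).comap (Subtype.val : Set.Ioi (0:ℝ) → ℝ)) := by
      refine SigmaFinite.of_map _ measurable_subtype_coe.aemeasurable ?_
      rw [(measurePreserving_subtype_coe measurableSet_Ioi).map_eq]
      infer_instance
    inferInstance
  calc ∫ w, h w ∂μ = ∫ x : ({(0)}ᶜ : Set V), h x.1 ∂(μ.comap (↑)) := by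
        rw [integral_subtype_comap (measurableSet_singleton _).compl fun x ↦ h x,
          restrict_compl_singleton]
    _ = ∫ x : Metric.sphere (0 : V) 1 × Set.Ioi (0 : ℝ), h ((x.2 : ℝ) • (x.1 : V))
          ∂(μ.toSphere.prod (.volumeIoiPow (Module.finrank ℝ V - 1))) := by
      rw [← μ.measurePreserving_homeomorphUnitSphereProd.integral_comp
        (Homeomorph.measurableEmbedding _)]
      refine integral_congr_ae (Filter.Eventually.of_forall fun x => ?_)
      have hx : ‖(x : V)‖ ≠ 0 := norm_ne_zero_iff.2 x.2
      simp [smul_smul, hx]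
    _ = ∫ x : Metric.sphere (0 : V) 1 × Set.Ioi (0 : ℝ),
          (((x.2 : ℝ) ^ (Module.finrank ℝ V - 1) : ℝ) : ℂ) * h ((x.2 : ℝ) • (x.1 : V))
          ∂(μ.toSphere.prod (.comap Subtype.val volume)) := by
      have hm : Measurable (fun r : Set.Ioi (0 : ℝ) => Real.toNNReal ((r : ℝ) ^ (Module.finrank ℝ V - 1))) :=
        (measurable_subtype_coe.pow_const _).real_toNNReal
      simp only [Measure.volumeIoiPow, ENNReal.ofReal]
      rw [prod_withDensity_right hm.coe_nnreal_ennreal]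
      rw [integral_withDensity_eq_integral_smul (f := fun x : Metric.sphere (0 : V) 1 × Set.Ioi (0 : ℝ) => Real.toNNReal ((x.2 : ℝ) ^ (Module.finrank ℝ V - 1))) (hm.comp measurable_snd)]
      refine integral_congr_ae (Filter.Eventually.of_forall fun x => ?_)
      simp only [NNReal.smul_def]
      rw [Real.coe_toNNReal _ (pow_nonneg x.2.2.out.le _), Complex.real_smul]
    _ = _ := by
      have e1 : MeasurePreserving (Subtype.val : Set.Ioi (0:ℝ) → ℝ)
          (.comap Subtype.val volume) (volume.restrict (Set.Ioi 0)) :=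
        measurePreserving_subtype_coe measurableSet_Ioi
      have e2 := (MeasurePreserving.id μ.toSphere).prod e1
      have e3 : MeasurableEmbedding (Prod.map (id : Metric.sphere (0 : V) 1 → _) (Subtype.val : Set.Ioi (0:ℝ) → ℝ)) :=
        MeasurableEmbedding.id.prodMap (MeasurableEmbedding.subtype_coe measurableSet_Ioi)
      exact e2.integral_comp e3 (fun x : Metric.sphere (0 : V) 1 × ℝ => ((x.2 ^ (Module.finrank ℝ V - 1) : ℝ) : ℂ) * h (x.2 • (x.1 : V)))

theorem bry_restrict {V : Type} [NormedAddCommGroup V] [NormedSpace ℝ V] [FiniteDimensional ℝ V]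
    [MeasurableSpace V] [BorelSpace V] (σ : Measure (Metric.sphere (0 : V) 1)) [IsFiniteMeasure σ]
    (R : ℝ) (G : Metric.sphere (0 : V) 1 × ℝ → ℂ) (hG : ∀ x, R < x.2 → G x = 0) :
    ∫ x, G x ∂(σ.prod (volume.restrict (Set.Ioi 0))) = ∫ x, G x ∂(bryM σ R) := by
  unfold bryM
  have h1 : σ.prod (volume.restrict (Set.Ioi (0:ℝ))) = (σ.prod volume).restrict (Set.univ ×ˢ Set.Ioi 0) := by
    rw [← Measure.prod_restrict, Measure.restrict_univ]
  have h2 : σ.prod (volume.restrict (Set.Ioc (0:ℝ) R)) = (σ.prod volume).restrict (Set.univ ×ˢ Set.Ioc 0 R) := by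
    rw [← Measure.prod_restrict, Measure.restrict_univ]
  rw [h1, h2]
  refine setIntegral_eq_of_subset_of_forall_sdiff_eq_zero (MeasurableSet.univ.prod measurableSet_Ioi) ?_ ?_
  · exact Set.prod_mono le_rfl Set.Ioc_subset_Ioi_self
  · rintro x ⟨h3, h4⟩
    apply hG
    by_contra h5
    exact h4 ⟨trivial, h3.2, not_lt.1 h5⟩

/-- Polar coordinates for the beta integral. -/
theorem bry_beta_polar {V G : Type} [NormedAddCommGroup V] [NormedSpace ℝ V] [FiniteDimensional ℝ V]
    [MeasurableSpace V] [BorelSpace V] [Nontrivial V] (μ : Measure V) [μ.IsAddHaarMeasure]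
    [NormedAddCommGroup G] [NormedSpace ℝ G] (f : V → G) (g : ℝ × V → G)
    (hg : ∀ r θ, f (r • θ) = r • g (r, θ)) (φ : V → ℝ) (R : ℝ) (hR : 0 < R)
    (hφ : ∀ w, R < ‖w‖ → φ w = 0) (s : ℂ) :
    ∫ w, (((‖w‖ ^ 2 + ‖f w‖ ^ 2 : ℝ) : ℂ) ^ (s / 2)) * (φ w : ℂ) ∂μ =
      ∫ x, bryK (fun p => Real.log (1 + ‖g p‖ ^ 2) / 2) (fun p => φ (p.1 • p.2))
        (Module.finrank ℝ V) s x ∂(bryM μ.toSphere R) := by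
  have : SecondCountableTopology V := by
    have := FiniteDimensional.proper_real V
    infer_instance
  rw [bry_polar, bry_restrict _ R]
  · refine integral_congr_ae ?_
    filter_upwards [bry_ae_mem μ.toSphere R] with x hx
    obtain ⟨θ, r⟩ := x
    have hr : 0 < r := hx.1
    have hθ : ‖(θ : V)‖ = 1 := by simp
    have hrc : (r : ℂ) ≠ 0 := by exact_mod_cast hr.ne'
    simp only [bryK]
    have hpos : 0 < 1 + ‖g (r, (θ : V))‖ ^ 2 := by positivity
    have e1 : ‖r • (θ : V)‖ ^ 2 + ‖f (r • (θ : V))‖ ^ 2 = r ^ 2 * (1 + ‖g (r, (θ : V))‖ ^ 2) := by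
      rw [hg, norm_smul, norm_smul, hθ, Real.norm_of_nonneg hr.le]; ring
    have e2 : ((r ^ 2 * (1 + ‖g (r, (θ : V))‖ ^ 2) : ℝ) : ℂ) ^ (s / 2) =
        (r : ℂ) ^ s * exp (s * ((Real.log (1 + ‖g (r, (θ : V))‖ ^ 2) / 2 : ℝ) : ℂ)) := by
      have hne : ((r ^ 2 * (1 + ‖g (r, (θ : V))‖ ^ 2) : ℝ) : ℂ) ≠ 0 := by
        exact_mod_cast (by positivity : r ^ 2 * (1 + ‖g (r, (θ : V))‖ ^ 2) ≠ 0)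
      rw [Complex.cpow_def_of_ne_zero hne, Complex.cpow_def_of_ne_zero hrc, ← Complex.exp_add,
        ← Complex.ofReal_log (by positivity), ← Complex.ofReal_log hr.le,
        Real.log_mul (by positivity) hpos.ne', Real.log_pow]
      congr 1
      push_cast
      ring
    have e3 : (r : ℂ) ^ (s + (Module.finrank ℝ V : ℂ) - 1) =
        (r : ℂ) ^ s * ((r ^ (Module.finrank ℝ V - 1) : ℝ) : ℂ) := by
      have hd : 1 ≤ Module.finrank ℝ V := Module.finrank_pos
      have : s + (Module.finrank ℝ V : ℂ) - 1 = s + ((Module.finrank ℝ V - 1 : ℕ) : ℂ) := by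
        push_cast [Nat.cast_sub hd]; ring
      rw [this, Complex.cpow_add _ _ hrc, Complex.cpow_natCast, Complex.ofReal_pow]
    rw [e1, e2, e3]
    ring
  · rintro ⟨θ, r⟩ hr
    have hr' : R < r := hr
    have : φ (r • (θ : V)) = 0 := by
      apply hφ
      rw [norm_smul, Real.norm_of_nonneg (by linarith)]
      simpa using hr'
    simp [this]

theorem bry_isOpen_half (t : ℝ) : IsOpen {s : ℂ | t < s.re} :=
  isOpen_lt continuous_const Complex.continuous_re

theorem bry_ext {V : Type} [NormedAddCommGroup V] [NormedSpace ℝ V] [FiniteDimensional ℝ V]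
    [MeasurableSpace V] [BorelSpace V] (σ : Measure (Metric.sphere (0 : V) 1)) [IsFiniteMeasure σ]
    (hσ : ∀ o : Metric.sphere (0 : V) 1 → ℂ, (∀ θ, o (-θ) = - o θ) → ∫ θ, o θ ∂σ = 0)
    (L : ℝ × V → ℝ) (hL : ContDiff ℝ (⊤ : ℕ∞) L) (hLe : ∀ r θ, L (-r, -θ) = L (r, θ))
    (R₀ R : ℝ) (hR₀ : R₀ < R) (hR : 1 ≤ R) (N : ℕ) :
    ∀ (a : ℕ) (c : ℝ × V → ℝ), ContDiff ℝ (⊤ : ℕ∞) c →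
      (∀ θ : Metric.sphere (0 : V) 1, ∀ r, R₀ < r → c (r, θ) = 0) →
      ((∀ r θ, c (-r, -θ) = c (r, θ)) → ∃ E : ℂ → ℂ,
        DifferentiableOn ℂ E {s | -(a : ℝ) - N < s.re} ∧
        ∀ s : ℂ, -(a : ℝ) < s.re →
          ∫ x, bryK L c a s x ∂(bryM σ R) = Gamma ((s + a) / 2) * E s) ∧
      ((∀ r θ, c (-r, -θ) = - c (r, θ)) → ∃ E : ℂ → ℂ,
        DifferentiableOn ℂ E {s | -(a : ℝ) - N < s.re} ∧
        ∀ s : ℂ, -(a : ℝ) < s.re →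
          ∫ x, bryK L c a s x ∂(bryM σ R) = Gamma ((s + a + 1) / 2) * E s) := by
  induction N with
  | zero =>
    intro a c hc hcR
    have hdiff : DifferentiableOn ℂ (fun s => ∫ x, bryK L c a s x ∂(bryM σ R))
        {s | -(a : ℝ) - (0 : ℕ) < s.re} := fun s hs =>
      (bry_differentiableAt σ L c hL.continuous hc.continuous a s R hR
        (by simpa using hs)).differentiableWithinAt
    constructor
    · intro _
      refine ⟨fun s => (∫ x, bryK L c a s x ∂(bryM σ R)) * (Gamma ((s + a) / 2))⁻¹, ?_, ?_⟩
      · refine hdiff.mul (Differentiable.differentiableOn ?_)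
        exact differentiable_one_div_Gamma.comp (g := fun s : ℂ => (Gamma s)⁻¹)
          (f := fun s : ℂ => (s + a) / 2) (by fun_prop)
      · intro s hs
        have : Gamma ((s + a) / 2) ≠ 0 := Gamma_ne_zero_of_re_pos (by simp; linarith)
        field_simp
    · intro _
      refine ⟨fun s => (∫ x, bryK L c a s x ∂(bryM σ R)) * (Gamma ((s + a + 1) / 2))⁻¹, ?_, ?_⟩
      · refine hdiff.mul (Differentiable.differentiableOn ?_)
        exact differentiable_one_div_Gamma.comp (g := fun s : ℂ => (Gamma s)⁻¹)
          (f := fun s : ℂ => (s + a + 1) / 2) (by fun_prop)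
      · intro s hs
        have : Gamma ((s + a + 1) / 2) ≠ 0 := Gamma_ne_zero_of_re_pos (by simp; linarith)
        field_simp
  | succ N ih =>
    intro a c hc hcR
    have hset : {s : ℂ | -((a + 1 : ℕ) : ℝ) - N < s.re} = {s : ℂ | -(a : ℝ) - (N + 1 : ℕ) < s.re} := by
      ext s; simp only [Set.mem_ofPred_eq]; push_cast
      constructor <;> intro h <;> linarith
    have hLp : ∀ r θ, bryD L (-r, -θ) = - bryD L (r, θ) := fun r θ => by
      simpa using bryD_parity L hL 1 (by simpa using hLe) r θ
    have hc1 : ContDiff ℝ (⊤ : ℕ∞) (fun p => bryD L p * c p) := (bryD_contDiff L hL).mul hc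
    have hc2 : ContDiff ℝ (⊤ : ℕ∞) (bryD c) := bryD_contDiff c hc
    have ih1 := ih (a + 1) (fun p => bryD L p * c p) hc1
      (fun θ r hr => by simp [hcR θ r hr])
    have ih2 := ih (a + 1) (bryD c) hc2
      (fun θ r hr => bryD_zero c hc R₀ θ (hcR θ) r hr)
    have hcR' : ∀ θ : Metric.sphere (0 : V) 1, c (R, θ) = 0 := fun θ => hcR θ R hR₀
    rw [hset] at ih1 ih2
    constructor
    · intro hce
      obtain ⟨E1, hE1, hE1'⟩ := ih1.2 (fun r θ => by simp [hLp, hce])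
      obtain ⟨E2, hE2, hE2'⟩ := ih2.2 (fun r θ => by
        simpa using bryD_parity c hc 1 (by simpa using hce) r θ)
      refine ⟨fun s => -(s * E1 s + E2 s) / 2, ?_, ?_⟩
      · exact (((differentiableOn_id.mul hE1).add hE2).neg).div_const 2
      · intro s hs
        have hs' : -((a + 1 : ℕ) : ℝ) < s.re := by push_cast; linarith
        have key := bry_ibp σ L c hL hc a s R hR hs hcR'
        have hsa : s + a ≠ 0 := fun h => by
          have : (s + a).re = 0 := by simp [h]
          simp at this; linarith
        have hG : Gamma ((s + (a + 1 : ℕ) + 1) / 2) = (s + a) / 2 * Gamma ((s + a) / 2) := by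
          rw [← Complex.Gamma_add_one _ (div_ne_zero hsa two_ne_zero)]
          congr 1; push_cast; ring
        rw [hE1' s hs', hE2' s hs', hG] at key
        apply mul_left_cancel₀ hsa
        linear_combination key
    · intro hco
      obtain ⟨E1, hE1, hE1'⟩ := ih1.1 (fun r θ => by simp [hLp, hco])
      obtain ⟨E2, hE2, hE2'⟩ := ih2.1 (fun r θ => by
        simpa using bryD_parity c hc (-1) (by simpa using hco) r θ)
      set W : ℂ → ℂ := fun s => s * E1 s + E2 s with hW
      have hWd : DifferentiableOn ℂ W {s | -(a : ℝ) - (N + 1 : ℕ) < s.re} :=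
        (differentiableOn_id.mul hE1).add hE2
      have hW0 : W (-(a : ℂ)) = 0 := by
        have h0 := bry_odd_zero σ hσ L c hL hc a R hR hcR' hLe hco
        have hs' : -((a + 1 : ℕ) : ℝ) < (-(a : ℂ)).re := by simp
        rw [hE1' _ hs', hE2' _ hs'] at h0
        have hG : Gamma ((-(a : ℂ) + (a + 1 : ℕ)) / 2) ≠ 0 :=
          Gamma_ne_zero_of_re_pos (by simp)
        apply mul_left_cancel₀ hG
        simp only [hW]
        linear_combination h0
      refine ⟨fun s => - dslope W (-(a : ℂ)) s, ?_, ?_⟩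
      · refine DifferentiableOn.neg ?_
        refine (Complex.differentiableOn_dslope ?_).2 hWd
        refine (bry_isOpen_half _).mem_nhds ?_
        simp only [Set.mem_ofPred_eq, neg_re, natCast_re]
        push_cast
        linarith [(Nat.cast_nonneg N : (0:ℝ) ≤ N)]
      · intro s hs
        have hs' : -((a + 1 : ℕ) : ℝ) < s.re := by push_cast; linarith
        have key := bry_ibp σ L c hL hc a s R hR hs hcR'
        have hsa : s + a ≠ 0 := fun h => by
          have : (s + a).re = 0 := by simp [h]
          simp at this; linarith
        have hne : s ≠ -(a : ℂ) := fun h => hsa (by rw [h]; ring)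
        rw [hE1' s hs', hE2' s hs'] at key
        have hG : Gamma ((s + (a + 1 : ℕ)) / 2) = Gamma ((s + a + 1) / 2) := by
          congr 1; push_cast; ring
        rw [hG] at key
        have hds : (s + a) * dslope W (-(a : ℂ)) s = W s := by
          rw [dslope_of_ne _ hne, slope_def_field, hW0, sub_neg_eq_add, sub_zero]
          field_simp
        apply mul_left_cancel₀ hsa
        have : W s = s * E1 s + E2 s := rfl
        linear_combination key + Gamma ((s + a + 1) / 2) * (hds + this)

/-- Gluing the continuations to increasing half planes. -/
theorem bry_glue (a : ℕ) (I : ℂ → ℂ)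
    (h : ∀ N : ℕ, ∃ E : ℂ → ℂ, DifferentiableOn ℂ E {s | -(a : ℝ) - N < s.re} ∧
        ∀ s : ℂ, -(a : ℝ) < s.re → I s = Gamma ((s + a) / 2) * E s) :
    ∃ E : ℂ → ℂ, Differentiable ℂ E ∧
      ∀ s : ℂ, -(a : ℝ) < s.re → I s = Gamma ((s + a) / 2) * E s := by
  choose E hE hE' using h
  have hmono : ∀ M N : ℕ, M ≤ N → Set.EqOn (E M) (E N) {s | -(a : ℝ) - M < s.re} := by
    intro M N hMN
    have hMN' : (M : ℝ) ≤ N := by exact_mod_cast hMN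
    have hA : AnalyticOnNhd ℂ (E M) {s | -(a : ℝ) - M < s.re} :=
      (hE M).analyticOnNhd (bry_isOpen_half _)
    have hB : AnalyticOnNhd ℂ (E N) {s | -(a : ℝ) - M < s.re} :=
      DifferentiableOn.analyticOnNhd ((hE N).mono fun s hs => by
        simp only [Set.mem_ofPred_eq] at hs ⊢
        linarith) (bry_isOpen_half _)
    refine hA.eqOn_of_preconnected_of_eventuallyEq hB
      (convex_halfSpace_re_gt _).isPreconnected (z₀ := 0 + 1) ?_ ?_
    · simp only [Set.mem_ofPred_eq, zero_add, one_re]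
      have : (0:ℝ) ≤ a := Nat.cast_nonneg _
      have : (0:ℝ) ≤ M := Nat.cast_nonneg _
      linarith
    · have : {s : ℂ | -(a : ℝ) < s.re} ∈ nhds ((0:ℂ) + 1) := by
        refine (bry_isOpen_half _).mem_nhds ?_
        simp only [Set.mem_ofPred_eq, zero_add, one_re]
        have : (0:ℝ) ≤ a := Nat.cast_nonneg _
        linarith
      filter_upwards [this] with s hs
      have hG : Gamma ((s + a) / 2) ≠ 0 := by
        refine Gamma_ne_zero_of_re_pos ?_
        have : -(a : ℝ) < s.re := hs
        simp; linarith
      apply mul_left_cancel₀ hG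
      rw [← hE' M s hs, ← hE' N s hs]
  have hall : ∀ (M N : ℕ) (s : ℂ), -(a : ℝ) - M < s.re → -(a : ℝ) - N < s.re → E M s = E N s := by
    intro M N s h1 h2
    rcases le_total M N with h | h
    · exact hmono M N h h1
    · exact (hmono N M h h2).symm
  have hν : ∀ s : ℂ, -(a : ℝ) - ((⌈-s.re⌉₊ + 1 : ℕ) : ℝ) < s.re := by
    intro s
    have h1 := Nat.le_ceil (-s.re)
    have : (0:ℝ) ≤ a := Nat.cast_nonneg _
    push_cast
    linarith
  refine ⟨fun s => E (⌈-s.re⌉₊ + 1) s, ?_, ?_⟩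
  · intro s₀
    have hmem := (bry_isOpen_half _).mem_nhds (hν s₀ : s₀ ∈ {s : ℂ | _ < s.re})
    refine ((hE (⌈-s₀.re⌉₊ + 1)).differentiableAt hmem).congr_of_eventuallyEq ?_
    filter_upwards [hmem] with s hs
    exact hall _ _ s (hν s) hs
  · intro s hs
    exact hE' _ s hs

theorem bry_gamma_pole (k : ℕ) : ∃ H : ℂ → ℂ, DifferentiableAt ℂ H (-(k : ℂ)) ∧
    ∀ z : ℂ, z ≠ -(k : ℂ) → H z = (z + k) * Gamma z := by
  induction k with
  | zero =>
    refine ⟨fun z => Gamma (z + 1), ?_, ?_⟩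
    · have h : DifferentiableAt ℂ Gamma (-((0:ℕ) : ℂ) + 1) := by
        refine differentiableAt_Gamma _ fun m hm => ?_
        have := congrArg Complex.re hm
        simp at this
        have h2 : (0:ℝ) ≤ m := Nat.cast_nonneg _
        linarith
      exact h.comp (f := fun z : ℂ => z + 1) _ (by fun_prop)
    · intro z hz
      have hz' : z ≠ 0 := by simpa using hz
      simp [Complex.Gamma_add_one z hz']
  | succ k ih =>
    obtain ⟨H, hH, hH'⟩ := ih
    refine ⟨fun z => H (z + 1) / z, ?_, ?_⟩
    · have hne : (-((k + 1 : ℕ) : ℂ)) ≠ 0 := neg_ne_zero.2 (Nat.cast_ne_zero.2 (by simp))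
      refine DifferentiableAt.div ?_ differentiableAt_id hne
      have e : -((k + 1 : ℕ) : ℂ) + 1 = -(k : ℂ) := by push_cast; ring
      rw [← e] at hH
      exact hH.comp (f := fun z : ℂ => z + 1) _ (by fun_prop)
    · intro z hz
      by_cases hz0 : z = 0
      · simp [hz0, Complex.Gamma_zero]
      · have : z + 1 ≠ -(k : ℂ) := fun h => hz (by push_cast; linear_combination h)
        simp only []
        rw [hH' _ this, Complex.Gamma_add_one z hz0]
        field_simp
        push_cast
        ring

/-- Theorem 3.3, analytic continuation: the localized Brylinski beta
function `B(s) = ∫_{ℝⁿ} (‖w‖² + ‖f w‖²)^(s/2) φ(w) dw` (defined for `Re s > -n`)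
extends to a meromorphic function on `ℂ` with at worst simple poles at the points
`-n - 2k`, `k ∈ ℕ`. -/
theorem brylinski_beta_local_meromorphic_continuation
    (n m : ℕ) (hn : 2 ≤ n) (hm : 1 ≤ m)
    (f : EuclideanSpace ℝ (Fin n) → EuclideanSpace ℝ (Fin m))
    (hf : ContDiff ℝ (⊤ : ℕ∞) f) (hf0 : f 0 = 0) (hdf0 : fderiv ℝ f 0 = 0)
    (φ : EuclideanSpace ℝ (Fin n) → ℝ)
    (hφ : ContDiff ℝ (⊤ : ℕ∞) φ) (hφc : HasCompactSupport φ) :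
    ∃ F : ℂ → ℂ,
      (∀ s : ℂ, -(n : ℝ) < s.re →
        F s = ∫ w : EuclideanSpace ℝ (Fin n),
          (((‖w‖ ^ 2 + ‖f w‖ ^ 2 : ℝ) : ℂ) ^ (s / 2)) * (φ w : ℂ)) ∧
      (∀ s : ℂ, (∀ k : ℕ, s ≠ -(n : ℂ) - 2 * k) → DifferentiableAt ℂ F s) ∧
      (∀ k : ℕ, ∃ G : ℂ → ℂ, DifferentiableAt ℂ G (-(n : ℂ) - 2 * k) ∧
        ∀ s : ℂ, s ≠ -(n : ℂ) - 2 * k → G s = (s - (-(n : ℂ) - 2 * k)) * F s) := by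
  have hnt : Nontrivial (EuclideanSpace ℝ (Fin n)) := by
    apply Module.nontrivial_of_finrank_pos (R := ℝ)
    rw [finrank_euclideanSpace_fin]; omega
  obtain ⟨g, hg, hfg, hgo⟩ := bry_hadamard f hf hf0
  obtain ⟨R₀, hR₀⟩ := hφc.isCompact.isBounded.exists_norm_le
  have hφ0 : ∀ w, max R₀ 0 < ‖w‖ → φ w = 0 := by
    intro w hw
    by_contra h
    have := hR₀ w (subset_tsupport φ h)
    have := le_max_left R₀ 0
    linarith
  set R : ℝ := max R₀ 0 + 1 with hRdef
  have hR : 1 ≤ R := by simp [hRdef]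
  have hLs : ContDiff ℝ (⊤ : ℕ∞) (fun p => Real.log (1 + ‖g p‖ ^ 2) / 2) := by
    refine ContDiff.div_const (ContDiff.log ?_ fun p => by positivity) 2
    exact contDiff_const.add (hg.norm_sq ℝ)
  have hcs : ContDiff ℝ (⊤ : ℕ∞) (fun p : ℝ × EuclideanSpace ℝ (Fin n) => φ (p.1 • p.2)) :=
    hφ.comp (by fun_prop)
  obtain ⟨E, hE, hE'⟩ := bry_glue n _ fun N =>
    (bry_ext (volume : Measure (EuclideanSpace ℝ (Fin n))).toSphere
      (fun o ho => bry_toSphere_odd volume o ho) (fun p => Real.log (1 + ‖g p‖ ^ 2) / 2) hLs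
      (fun r θ => by simp [hgo]) (max R₀ 0) R (by simp [hRdef]) hR N n
      (fun p => φ (p.1 • p.2)) hcs (fun θ r hr => by
        have h0 := le_max_right R₀ 0
        apply hφ0
        simp only
        rw [norm_smul, Real.norm_of_nonneg (by linarith)]
        simpa using hr)).1 (fun r θ => by simp)
  refine ⟨fun s => Gamma ((s + n) / 2) * E s, ?_, ?_, ?_⟩
  · intro s hs
    simp only
    rw [← hE' s hs, bry_beta_polar volume f g hfg φ R (by linarith)
      (fun w hw => hφ0 w (by simp only [hRdef] at hw; linarith)) s, finrank_euclideanSpace_fin]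
  · intro s hs
    refine DifferentiableAt.mul ?_ (hE s)
    have h : DifferentiableAt ℂ Gamma ((s + n) / 2) := by
      refine differentiableAt_Gamma _ fun k hk => hs k ?_
      linear_combination 2 * hk
    exact h.comp (f := fun z : ℂ => (z + n) / 2) _ (by fun_prop)
  · intro k
    obtain ⟨H, hH, hH'⟩ := bry_gamma_pole k
    refine ⟨fun s => 2 * H ((s + n) / 2) * E s, ?_, ?_⟩
    · refine DifferentiableAt.mul (DifferentiableAt.const_mul ?_ 2) (hE _)
      have e : ((-(n : ℂ) - 2 * k) + n) / 2 = -(k : ℂ) := by ring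
      rw [← e] at hH
      exact hH.comp (f := fun z : ℂ => (z + n) / 2) _ (by fun_prop)
    · intro s hs
      simp only
      rw [hH' _ fun h => hs (by linear_combination 2 * h)]
      ring
end

section
/- Let n ≥ 2 and m ≥ 1, let f : ℝⁿ → ℝᵐ be a C^∞ function with f(0) = 0 and Df(0) = 0, and let φ : ℝⁿ → ℝ be a C^∞ compactly supported function. For Re s > -n define B(s) = ∫_{ℝⁿ} (‖w‖² + ‖f(w)‖²)^{s/2} φ(w) dw. Then, as s → −n within the half-plane {Re s > −n}, the limit of (s + n)·B(s) exists and equals ω_{n−1} · φ(0), where ω_{n−1} = 2π^{n/2}/Γ(n/2) is the (n−1)-dimensional area of the unit sphere in ℝⁿ. -/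
open MeasureTheory Complex Filter

lemma bry_quad {n m : ℕ} (f : EuclideanSpace ℝ (Fin n) → EuclideanSpace ℝ (Fin m))
    (hf : ContDiff ℝ (⊤ : ℕ∞) f) (hf0 : f 0 = 0) (hdf0 : fderiv ℝ f 0 = 0) (R : ℝ) :
    ∃ C : ℝ, 0 ≤ C ∧ ∀ w, ‖w‖ ≤ R → ‖f w‖ ≤ C * ‖w‖ ^ 2 := by
  have h1 : ContDiff ℝ 1 (fderiv ℝ f) := hf.fderiv_right (by norm_cast)
  have hd : Differentiable ℝ f := hf.differentiable (by simp)
  have hd1 : Differentiable ℝ (fderiv ℝ f) := h1.differentiable (by simp)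
  have hc : Continuous (fderiv ℝ (fderiv ℝ f)) := h1.continuous_fderiv (by simp)
  obtain ⟨K, hK⟩ := (isCompact_closedBall (0 : EuclideanSpace ℝ (Fin n)) R).exists_bound_of_continuousOn
    (f := fderiv ℝ (fderiv ℝ f)) hc.continuousOn
  refine ⟨max K 0, le_max_right _ _, fun w hw => ?_⟩
  have key : ∀ x, ‖x‖ ≤ R → ‖fderiv ℝ f x‖ ≤ max K 0 * ‖x‖ := by
    intro x hx
    have := (convex_closedBall (0 : EuclideanSpace ℝ (Fin n)) R).norm_image_sub_le_of_norm_fderiv_le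
      (f := fderiv ℝ f) (C := max K 0) (x := 0) (y := x) (fun y _ => hd1 y)
      (fun y hy => (hK y hy).trans (le_max_left _ _))
      (by simpa using (norm_nonneg x).trans hx) (by simpa using hx)
    simpa [hdf0] using this
  have := (convex_closedBall (0 : EuclideanSpace ℝ (Fin n)) ‖w‖).norm_image_sub_le_of_norm_fderiv_le
      (f := f) (C := max K 0 * ‖w‖) (x := 0) (y := w) (fun y _ => hd y)
      (fun y hy => by
        have hy' : ‖y‖ ≤ ‖w‖ := by simpa using hy
        exact (key y (hy'.trans hw)).trans (by gcongr)) (by simp) (by simp)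
  simp only [hf0, sub_zero] at this
  nlinarith

lemma bry_pow_aux {n : ℕ} (hn : 2 ≤ n) (s : ℂ) {y : ℝ} (hy : 0 < y) :
    y ^ (n - 1) • (y : ℂ) ^ s = (y : ℂ) ^ (s + n - 1) := by
  have hy' : (y : ℂ) ≠ 0 := by exact_mod_cast hy.ne'
  have : s + n - 1 = ((n - 1 : ℕ) : ℂ) + s := by
    rw [Nat.cast_sub (by omega)]; push_cast; ring
  rw [this, Complex.cpow_add _ _ hy', Complex.cpow_natCast, Complex.real_smul]
  push_cast; rfl

lemma bry_integrable_s8 {n : ℕ} (hn : 2 ≤ n) (s : ℂ) (hs : -(n : ℝ) < s.re) {R : ℝ} (hR : 0 < R) :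
    IntegrableOn (fun w : EuclideanSpace ℝ (Fin n) => (‖w‖ : ℂ) ^ s) (Metric.ball 0 R) := by
  have : Nontrivial (EuclideanSpace ℝ (Fin n)) := by
    have : Nonempty (Fin n) := ⟨⟨0, by omega⟩⟩
    infer_instance
  rw [integrableOn_fun_norm_addHaar volume (f := fun y : ℝ => (y : ℂ) ^ s)]
  rw [integrableOn_congr_fun (g := fun y : ℝ => (y : ℂ) ^ (s + n - 1)) ?_ measurableSet_Ioo]
  · rw [intervalIntegral.integrableOn_Ioo_cpow_iff hR]
    simp; linarith
  · intro y hy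
    simp only [finrank_euclideanSpace, Fintype.card_fin]
    exact bry_pow_aux hn s hy.1

lemma bry_radial {n : ℕ} (hn : 2 ≤ n) (s : ℂ) (hs : -(n : ℝ) < s.re) {R : ℝ} (hR : 0 < R) :
    (s + n) * ∫ w in Metric.ball (0 : EuclideanSpace ℝ (Fin n)) R, (‖w‖ : ℂ) ^ s
      = ((2 * Real.pi ^ ((n : ℝ) / 2) / Real.Gamma ((n : ℝ) / 2) : ℝ) : ℂ) * (R : ℂ) ^ (s + n) := by
  have : Nonempty (Fin n) := ⟨⟨0, by omega⟩⟩
  have hsn : s + n ≠ 0 := by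
    intro h
    have := congrArg Complex.re h
    simp at this; linarith
  have h1 : ∫ w in Metric.ball (0 : EuclideanSpace ℝ (Fin n)) R, (‖w‖ : ℂ) ^ s
      = ∫ w : EuclideanSpace ℝ (Fin n), (Set.Iio R).indicator (fun y : ℝ => (y : ℂ) ^ s) ‖w‖ := by
    rw [← integral_indicator measurableSet_ball]
    congr 1; ext w
    simp [Set.indicator]
  have h2 : ∫ y in Set.Ioi (0 : ℝ), y ^ (n - 1) • (Set.Iio R).indicator (fun y : ℝ => (y : ℂ) ^ s) y
      = (R : ℂ) ^ (s + n) / (s + n) := by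
    have : ∫ y in Set.Ioi (0 : ℝ), y ^ (n - 1) • (Set.Iio R).indicator (fun y : ℝ => (y : ℂ) ^ s) y
      = ∫ y in Set.Ioi (0 : ℝ), (Set.Iio R).indicator (fun y : ℝ => (y : ℂ) ^ (s + n - 1)) y := by
      refine setIntegral_congr_fun measurableSet_Ioi fun y hy => ?_
      by_cases h : y < R
      · simp only [Set.indicator, Set.mem_Iio, h, if_true]
        exact bry_pow_aux hn s hy
      · simp [Set.indicator, h]
    rw [this, setIntegral_indicator measurableSet_Iio, Set.Ioi_inter_Iio,
      ← integral_Ioc_eq_integral_Ioo, ← intervalIntegral.integral_of_le hR.le, integral_cpow]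
    · simp [Complex.zero_cpow hsn]
    · left; simp; linarith
  have hv : volume.real (Metric.ball (0 : EuclideanSpace ℝ (Fin n)) 1)
      = Real.pi ^ ((n : ℝ) / 2) / Real.Gamma ((n : ℝ) / 2 + 1) := by
    rw [Measure.real, EuclideanSpace.volume_ball]
    have : 0 < Real.Gamma ((n : ℝ) / 2 + 1) := Real.Gamma_pos_of_pos (by positivity)
    simp only [Fintype.card_fin, ENNReal.ofReal_one, one_pow, one_mul]
    rw [ENNReal.toReal_ofReal (by positivity), Real.sqrt_eq_rpow, ← Real.rpow_mul_natCast Real.pi_pos.le]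
    congr 2; ring
  have hG : 0 < Real.Gamma ((n : ℝ) / 2) := Real.Gamma_pos_of_pos (by
    have : (2 : ℝ) ≤ n := by exact_mod_cast hn
    linarith)
  have hn0 : (n : ℝ) ≠ 0 := by positivity
  rw [h1, integral_fun_norm_addHaar volume, finrank_euclideanSpace, Fintype.card_fin, h2, hv,
    Real.Gamma_add_one (by positivity), Complex.real_smul, nsmul_eq_mul]
  have e : Real.pi ^ ((n : ℝ) / 2) / ((n : ℝ) / 2 * Real.Gamma ((n : ℝ) / 2))
     = (2 * Real.pi ^ ((n : ℝ) / 2) / Real.Gamma ((n : ℝ) / 2)) / n := by field_simp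
  have hnc : (n : ℂ) ≠ 0 := by exact_mod_cast hn0
  rw [e, Complex.ofReal_div _ (n : ℝ), Complex.ofReal_natCast]
  field_simp

lemma bry_exp (z : ℂ) : ‖Complex.exp z - 1‖ ≤ ‖z‖ * Real.exp ‖z‖ := by
  simpa using Complex.norm_exp_sub_sum_le_norm_mul_exp z 1

lemma bry_point {r t C R N : ℝ} (hr : 0 < r) (ht0 : 0 ≤ t) (hN : 0 ≤ N) (hC : 0 ≤ C)
    (hrR : r ≤ R) (ht : t ≤ C * r ^ 2) (s : ℂ) (hs : ‖s‖ ≤ N) :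
    ‖((r ^ 2 + t ^ 2 : ℝ) : ℂ) ^ (s / 2) - (r : ℂ) ^ s‖
      ≤ ‖(r : ℂ) ^ s‖ * (N * C ^ 2 * R * Real.exp (N * C ^ 2 * R ^ 2) * r) := by
  set u : ℝ := t ^ 2 / r ^ 2 with hu
  have hu0 : 0 ≤ u := by positivity
  have huC : u ≤ C ^ 2 * r ^ 2 := by
    rw [hu, div_le_iff₀ (by positivity)]
    calc t ^ 2 ≤ (C * r ^ 2) ^ 2 := by gcongr
      _ = _ := by ring
  have hQ : r ^ 2 + t ^ 2 = r ^ 2 * (1 + u) := by rw [hu]; field_simp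
  have hpos : 0 < r ^ 2 * (1 + u) := by positivity
  have hlog0 : 0 ≤ Real.log (1 + u) := Real.log_nonneg (by linarith)
  have hlog : Real.log (1 + u) ≤ u := by
    have := Real.log_le_sub_one_of_pos (show 0 < 1 + u by linarith); linarith
  have heq : ((r ^ 2 + t ^ 2 : ℝ) : ℂ) ^ (s / 2)
      = (r : ℂ) ^ s * Complex.exp ((Real.log (1 + u) : ℂ) * (s / 2)) := by
    rw [hQ, Complex.cpow_def_of_ne_zero (by exact_mod_cast hpos.ne'),
      Complex.cpow_def_of_ne_zero (by exact_mod_cast hr.ne'), ← Complex.ofReal_log hpos.le,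
      ← Complex.ofReal_log hr.le, Real.log_mul (by positivity) (by positivity), Real.log_pow,
      ← Complex.exp_add]
    push_cast; congr 1; ring
  have hz : ‖(Real.log (1 + u) : ℂ) * (s / 2)‖ ≤ N * C ^ 2 * r ^ 2 := by
    rw [norm_mul, Complex.norm_real, Real.norm_of_nonneg hlog0, norm_div]
    have : ‖s‖ / ‖(2 : ℂ)‖ ≤ N := by
      simp only [Complex.norm_ofNat]; linarith [norm_nonneg s]
    calc _ ≤ (C ^ 2 * r ^ 2) * N := by
          apply mul_le_mul (hlog.trans huC) this (by positivity) (by positivity)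
      _ = _ := by ring
  rw [heq, ← mul_sub_one, norm_mul]
  gcongr
  refine (bry_exp _).trans ?_
  calc _ ≤ (N * C ^ 2 * r ^ 2) * Real.exp (N * C ^ 2 * r ^ 2) := by gcongr
    _ ≤ (N * C ^ 2 * (R * r)) * Real.exp (N * C ^ 2 * R ^ 2) := by
        have : r ^ 2 ≤ R * r := by nlinarith
        have hR : 0 < R := hr.trans_le hrR
        gcongr
    _ = _ := by ring



/-- the residue of the localized Brylinski beta function
`B(s) = ∫_{ℝⁿ} (‖w‖² + ‖f w‖²)^(s/2) φ(w) dw` at its first pole `s = -n`: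
as `s → -n` within the half-plane `Re s > -n`, `(s + n)·B(s) → ω_{n-1} φ(0)`,
where `ω_{n-1} = 2 π^(n/2) / Γ(n/2)`. -/
theorem brylinski_beta_local_first_residue
    (n m : ℕ) (hn : 2 ≤ n) (hm : 1 ≤ m)
    (f : EuclideanSpace ℝ (Fin n) → EuclideanSpace ℝ (Fin m))
    (hf : ContDiff ℝ (⊤ : ℕ∞) f) (hf0 : f 0 = 0) (hdf0 : fderiv ℝ f 0 = 0)
    (φ : EuclideanSpace ℝ (Fin n) → ℝ)
    (hφ : ContDiff ℝ (⊤ : ℕ∞) φ) (hφc : HasCompactSupport φ) :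
    Tendsto
      (fun s : ℂ => (s + n) * ∫ w : EuclideanSpace ℝ (Fin n),
        (((‖w‖ ^ 2 + ‖f w‖ ^ 2 : ℝ) : ℂ) ^ (s / 2)) * (φ w : ℂ))
      (nhdsWithin (-(n : ℂ)) {s : ℂ | -(n : ℝ) < s.re})
      (nhds (((2 * Real.pi ^ ((n : ℝ) / 2) / Real.Gamma ((n : ℝ) / 2)) * φ 0 : ℝ) : ℂ)) := by

  have : Nonempty (Fin n) := ⟨⟨0, by omega⟩⟩
  have hn2 : (2 : ℝ) ≤ n := by exact_mod_cast hn
  obtain ⟨R, hR1, hRφ⟩ : ∃ R : ℝ, 1 ≤ R ∧ ∀ w, R ≤ ‖w‖ → φ w = 0 := by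
    obtain ⟨R, hR⟩ := hφc.isBounded.subset_ball (0 : EuclideanSpace ℝ (Fin n))
    refine ⟨max R 1, le_max_right _ _, fun w hw => ?_⟩
    by_contra h
    have := hR (subset_tsupport _ h)
    simp at this
    exact absurd ((le_max_left R 1).trans hw) (not_le.2 this)
  have hR0 : 0 < R := by linarith
  obtain ⟨C, hC, hfC⟩ := bry_quad f hf hf0 hdf0 R
  obtain ⟨L, hL⟩ : ∃ L : NNReal, LipschitzWith L φ :=
    ContDiff.lipschitzWith_of_hasCompactSupport hφc hφ (by simp)
  obtain ⟨M, hM⟩ := hφc.exists_bound_of_continuous hφ.continuous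
  have hM0 : 0 ≤ M := (norm_nonneg _).trans (hM 0)
  set N : ℝ := n + 1 with hN
  set A : ℝ := N * C ^ 2 * R * Real.exp (N * C ^ 2 * R ^ 2) with hA
  have hA0 : 0 ≤ A := by positivity
  set S := Metric.ball (0 : EuclideanSpace ℝ (Fin n)) R with hS
  let F : ℂ → EuclideanSpace ℝ (Fin n) → ℂ := fun s w =>
    ((‖w‖ ^ 2 + ‖f w‖ ^ 2 : ℝ) : ℂ) ^ (s / 2) * (φ w : ℂ)
  let G : ℂ → EuclideanSpace ℝ (Fin n) → ℂ := fun s w => (‖w‖ : ℂ) ^ s * (φ 0 : ℂ)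
  let H : EuclideanSpace ℝ (Fin n) → ℝ := fun w =>
    ‖(‖w‖ : ℂ) ^ (1 - n : ℂ)‖ * (R * (A * M + L))
  have hH : IntegrableOn H S := by
    refine Integrable.mul_const (Integrable.norm ?_) _
    exact bry_integrable_s8 hn _ (by simp) hR0
  have hbound : ∀ s : ℂ, -(n : ℝ) < s.re → ‖s + n‖ < 1 → ∀ w ∈ S, ‖F s w - G s w‖ ≤ H w := by
    intro s hs hs1 w hw
    have hwR : ‖w‖ < R := by simpa [hS] using hw
    have hre : s.re + n < 1 := by
      have := (Complex.re_le_norm (s + n)).trans_lt hs1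
      simpa using this
    have hsN : ‖s‖ ≤ N := by
      have : ‖s‖ ≤ ‖s + n‖ + ‖(n : ℂ)‖ := by
        simpa using norm_sub_le (s + n) (n : ℂ)
      rw [Complex.norm_natCast] at this
      linarith
    have hs0 : s ≠ 0 := by
      rintro rfl
      simp at hre; linarith
    rcases eq_or_ne w 0 with rfl | hw0
    · simp only [F, G, H, hf0]
      simp [Complex.zero_cpow hs0, Complex.zero_cpow (div_ne_zero hs0 two_ne_zero)]
      positivity
    have hr : 0 < ‖w‖ := norm_pos_iff.2 hw0
    have h1 := bry_point hr (norm_nonneg (f w)) (by positivity : 0 ≤ N) hC hwR.le (hfC w hwR.le) s hsN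
    have h2 : ‖φ w - φ 0‖ ≤ L * ‖w‖ := by simpa using hL.norm_sub_le w 0
    have h3 : ‖(‖w‖ : ℂ) ^ s‖ * ‖w‖ ≤ ‖(‖w‖ : ℂ) ^ (1 - n : ℂ)‖ * R := by
      rw [Complex.norm_cpow_eq_rpow_re_of_pos hr, Complex.norm_cpow_eq_rpow_re_of_pos hr]
      have e : ‖w‖ ^ s.re * ‖w‖ = ‖w‖ ^ (1 - n : ℂ).re * ‖w‖ ^ (s.re + n) := by
        rw [← Real.rpow_add hr, ← Real.rpow_add_one hr.ne']
        congr 1; simp; ring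
      rw [e]
      gcongr
      calc ‖w‖ ^ (s.re + n) ≤ R ^ (s.re + n) :=
            Real.rpow_le_rpow hr.le hwR.le (by linarith)
        _ ≤ R ^ (1 : ℝ) := Real.rpow_le_rpow_of_exponent_le hR1 hre.le
        _ = R := Real.rpow_one R
    have e : F s w - G s w = (((‖w‖ ^ 2 + ‖f w‖ ^ 2 : ℝ) : ℂ) ^ (s / 2) - (‖w‖ : ℂ) ^ s) * (φ w : ℂ)
        + (‖w‖ : ℂ) ^ s * ((φ w - φ 0 : ℝ) : ℂ) := by
      simp only [F, G]; push_cast; ring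
    rw [e]
    refine (norm_add_le _ _).trans ?_
    rw [norm_mul, norm_mul, Complex.norm_real, Complex.norm_real]
    calc _ ≤ (‖(‖w‖ : ℂ) ^ s‖ * (A * ‖w‖)) * M + ‖(‖w‖ : ℂ) ^ s‖ * (L * ‖w‖) := by
          gcongr
          exact hM w
      _ = (‖(‖w‖ : ℂ) ^ s‖ * ‖w‖) * (A * M + L) := by ring
      _ ≤ (‖(‖w‖ : ℂ) ^ (1 - n : ℂ)‖ * R) * (A * M + L) := by gcongr
      _ = H w := by simp only [H]; ring
  have hFm : ∀ s, Measurable (F s) := by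
    intro s
    have := hf.continuous.measurable
    have := hφ.continuous.measurable
    simp only [F]
    fun_prop
  have hGm : ∀ s, Measurable (G s) := by
    intro s
    simp only [G]
    fun_prop
  have hDint : ∀ s : ℂ, -(n : ℝ) < s.re → ‖s + n‖ < 1 → IntegrableOn (fun w => F s w - G s w) S := by
    intro s hs hs1
    refine Integrable.mono' hH ((hFm s).sub (hGm s)).aestronglyMeasurable ?_
    exact (ae_restrict_iff' measurableSet_ball).2 (Eventually.of_forall (hbound s hs hs1))
  set D : ℂ → ℂ := fun s => ∫ w in S, (F s w - G s w) with hD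
  have hev : ∀ᶠ s : ℂ in nhdsWithin (-(n : ℂ)) {s : ℂ | -(n : ℝ) < s.re},
      -(n : ℝ) < s.re ∧ ‖s + n‖ < 1 := by
    refine eventually_mem_nhdsWithin.and (nhdsWithin_le_nhds ?_)
    have := Metric.ball_mem_nhds (-(n : ℂ)) one_pos
    filter_upwards [this] with s hs
    simpa [dist_eq_norm] using hs
  have hlim0 : Tendsto (fun s : ℂ => s + n) (nhdsWithin (-(n : ℂ)) {s : ℂ | -(n : ℝ) < s.re})
      (nhds 0) := by
    have : Tendsto (fun s : ℂ => s + n) (nhds (-(n : ℂ))) (nhds (-(n : ℂ) + n)) :=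
      (continuous_id.add continuous_const).tendsto _
    rw [neg_add_cancel] at this
    exact this.mono_left nhdsWithin_le_nhds
  have hlimD : Tendsto (fun s => (s + n) * D s) (nhdsWithin (-(n : ℂ)) {s : ℂ | -(n : ℝ) < s.re})
      (nhds 0) := by
    refine hlim0.zero_mul_isBoundedUnder_le ⟨∫ w in S, H w, ?_⟩
    rw [eventually_map]
    filter_upwards [hev] with s hs
    exact norm_integral_le_of_norm_le hH
      ((ae_restrict_iff' measurableSet_ball).2 (Eventually.of_forall (hbound s hs.1 hs.2)))
  set ω : ℝ := 2 * Real.pi ^ ((n : ℝ) / 2) / Real.Gamma ((n : ℝ) / 2) with hω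
  have hlimR : Tendsto (fun s : ℂ => (ω : ℂ) * (R : ℂ) ^ (s + n) * (φ 0 : ℂ))
      (nhdsWithin (-(n : ℂ)) {s : ℂ | -(n : ℝ) < s.re}) (nhds ((ω : ℂ) * (φ 0 : ℂ))) := by
    have h := (hlim0.const_cpow (a := (R : ℂ)) (Or.inl (by exact_mod_cast hR0.ne')))
    rw [Complex.cpow_zero] at h
    simpa using (h.const_mul (ω : ℂ)).mul_const (φ 0 : ℂ)
  have hfin := hlimD.add hlimR
  rw [zero_add, ← Complex.ofReal_mul] at hfin
  refine hfin.congr' ?_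
  filter_upwards [hev] with s hs
  have hGint : IntegrableOn (G s) S := (bry_integrable_s8 hn s hs.1 hR0).mul_const _
  have e1 : ∫ w, F s w = ∫ w in S, F s w := by
    symm
    refine setIntegral_eq_integral_of_forall_compl_eq_zero fun w hw => ?_
    have : φ w = 0 := hRφ w (by simpa [hS] using hw)
    simp [F, this]
  have e2 : ∫ w in S, F s w = D s + ∫ w in S, G s w := by
    rw [hD, ← integral_add (hDint s hs.1 hs.2) hGint]
    simp
  have e3 : ∫ w in S, G s w = (∫ w in S, (‖w‖ : ℂ) ^ s) * (φ 0 : ℂ) := integral_mul_const _ _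
  change _ = (s + n) * ∫ w, F s w
  rw [e1, e2, e3, mul_add, ← mul_assoc, bry_radial hn s hs.1 hR0]
end

section
/- Let f : ℝ² → ℝ be a C^∞ function with f(0) = 0 and ∇f(0) = 0, and let ψ : ℝ² → ℝ be a C^∞ compactly supported function with ψ ≡ 1 on a neighborhood of 0. For Re s > -2 define B(s) = ∫_{ℝ²} (‖w‖² + f(w)²)^{s/2} ψ(w) √(1 + ‖∇f(w)‖²) dw. Then, as s → −2 within the half-plane {Re s > −2}, the limit of (s + 2)·B(s) exists and equals 2π. -/
open MeasureTheory Complex Filter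

lemma aux_ball (r : ℝ) (hr : 0 < r) (s : ℂ) (hs : -2 < s.re) :
    Integrable (fun w : EuclideanSpace ℝ (Fin 2) => (Set.Iio r).indicator (fun t : ℝ => (t : ℂ) ^ s) ‖w‖) ∧
    (s + 2) * ∫ w : EuclideanSpace ℝ (Fin 2), (Set.Iio r).indicator (fun t : ℝ => (t : ℂ) ^ s) ‖w‖
      = 2 * Real.pi * (r : ℂ) ^ (s + 2) := by
  have hs2 : s + 2 ≠ 0 := by
    intro h
    have := congrArg Complex.re h
    simp at this
    linarith
  have hs1 : -1 < (s + 1).re := by simp; linarith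
  have key : Set.EqOn (fun y : ℝ => y ^ (2 - 1) • (Set.Iio r).indicator (fun t : ℝ => (t : ℂ) ^ s) y)
      ((Set.Iio r).indicator (fun t : ℝ => (t : ℂ) ^ (s + 1))) (Set.Ioi 0) := by
    intro y hy
    have hy0 : (y : ℂ) ≠ 0 := by exact_mod_cast (ne_of_gt hy)
    by_cases h : y < r
    · simp [Set.indicator, h, Complex.cpow_add _ _ hy0, mul_comm]
    · simp [Set.indicator, h]
  have hii : IntegrableOn (fun t : ℝ => (t : ℂ) ^ (s + 1)) (Set.Ioo 0 r) := by
    have := intervalIntegral.intervalIntegrable_cpow' (a := 0) (b := r) hs1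
    rw [intervalIntegrable_iff_integrableOn_Ioo_of_le hr.le] at this
    exact this
  constructor
  · rw [integrable_fun_norm_addHaar]
    rw [finrank_euclideanSpace_fin, integrableOn_congr_fun key measurableSet_Ioi,
      integrableOn_indicator_iff measurableSet_Iio]
    rwa [Set.inter_comm, Set.Ioi_inter_Iio]
  · rw [integral_fun_norm_addHaar, finrank_euclideanSpace_fin,
      setIntegral_congr_fun measurableSet_Ioi key, setIntegral_indicator measurableSet_Iio,
      Set.Ioi_inter_Iio, ← integral_Ioc_eq_integral_Ioo, ← intervalIntegral.integral_of_le hr.le,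
      integral_cpow (Or.inl hs1)]
    have : s + 1 + 1 = s + 2 := by ring
    rw [this, Measure.real, EuclideanSpace.volume_ball_fin_two]
    simp [hs2, Complex.zero_cpow]
    field_simp
    rw [ENNReal.toReal_ofReal Real.pi_pos.le, mul_comm]

lemma aux_local (f : EuclideanSpace ℝ (Fin 2) → ℝ)
    (hf : ContDiff ℝ (⊤ : ℕ∞) f) (hf0 : f 0 = 0) (hgrad : gradient f 0 = 0) :
    ∃ C > 0, ∃ r > 0, ∀ w : EuclideanSpace ℝ (Fin 2), ‖w‖ < r →
      ‖gradient f w‖ ≤ C * ‖w‖ ∧ |f w| ≤ C * ‖w‖ ^ 2 := by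
  have hn : ∀ w, ‖gradient f w‖ = ‖fderiv ℝ f w‖ := fun w => by simp [gradient]
  have h0 : fderiv ℝ f 0 = 0 := by rw [← norm_eq_zero, ← hn, hgrad, norm_zero]
  have hd : DifferentiableAt ℝ (fderiv ℝ f) 0 :=
    ((hf.fderiv_right (m := 1) (by norm_num; exact WithTop.coe_le_coe.2 le_top)).differentiable (by norm_num)) 0
  have hO := hd.isBigO_sub
  obtain ⟨C, hC, hO⟩ := hO.exists_pos
  obtain ⟨r, hr, h⟩ := Metric.eventually_nhds_iff.1 hO.bound
  have hb : ∀ w, ‖w‖ < r → ‖fderiv ℝ f w‖ ≤ C * ‖w‖ := by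
    intro w hw
    simpa [h0] using h (y := w) (by simpa using hw)
  refine ⟨C, hC, r, hr, fun w hw => ⟨by rw [hn]; exact hb w hw, ?_⟩⟩
  have := (convex_closedBall (0 : EuclideanSpace ℝ (Fin 2)) ‖w‖).norm_image_sub_le_of_norm_fderiv_le
    (𝕜 := ℝ) (f := f) (C := C * ‖w‖) (x := 0) (y := w)
    (fun x _ => hf.differentiable (by simp) x)
    (fun x hx => by
      have hx' : ‖x‖ ≤ ‖w‖ := by simpa using hx
      exact (hb x (hx'.trans_lt hw)).trans (by gcongr)) (by simp) (by simp)
  simpa [hf0, pow_two, mul_assoc] using this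

/-- local comparison -/
lemma aux_cmp (ρ a S C : ℝ) (s : ℂ) (hρ : 0 < ρ) (hρ1 : ρ ≤ 1) (hC : 0 < C) (hCρ : C * ρ ≤ 1 / 2)
    (ha : |a| ≤ C * ρ ^ 2) (hS1 : 1 ≤ S) (hS : S ≤ 1 + C ^ 2 * ρ ^ 2)
    (hs : -2 < s.re) (hs' : ‖s‖ ≤ 3) :
    ‖((ρ ^ 2 + a ^ 2 : ℝ) : ℂ) ^ (s / 2) * (S : ℂ) - (ρ : ℂ) ^ s‖ ≤ 7 * C ^ 2 := by
  set x : ℝ := a ^ 2 / ρ ^ 2 with hx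
  have hx0 : 0 ≤ x := by positivity
  have ha2 : a ^ 2 ≤ (C * ρ ^ 2) ^ 2 := by
    rw [← sq_abs]; gcongr
  have hxC : x ≤ C ^ 2 * ρ ^ 2 := by
    rw [hx, div_le_iff₀ (by positivity)]; nlinarith
  have hCC : C ^ 2 * ρ ^ 2 ≤ 1 / 4 := by
    have : 0 < C * ρ := by positivity
    nlinarith
  have hT : ρ ^ 2 + a ^ 2 = ρ ^ 2 * (1 + x) := by rw [hx]; field_simp
  have hlog : Real.log (ρ ^ 2 + a ^ 2) = 2 * Real.log ρ + Real.log (1 + x) := by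
    rw [hT, Real.log_mul (by positivity) (by positivity), Real.log_pow]; norm_num
  have hl0 : 0 ≤ Real.log (1 + x) := Real.log_nonneg (by linarith)
  have hl1 : Real.log (1 + x) ≤ x := by
    have := Real.log_le_sub_one_of_pos (x := 1 + x) (by linarith); linarith
  set u : ℂ := (Real.log (1 + x) : ℂ) * (s / 2) with hu
  have hA : ((ρ ^ 2 + a ^ 2 : ℝ) : ℂ) ^ (s / 2) = (ρ : ℂ) ^ s * Complex.exp u := by
    have h1 : ((ρ ^ 2 + a ^ 2 : ℝ) : ℂ) ≠ 0 := by
      exact_mod_cast (by positivity : ρ ^ 2 + a ^ 2 ≠ 0)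
    rw [Complex.cpow_def_of_ne_zero h1, Complex.cpow_def_of_ne_zero (by exact_mod_cast hρ.ne'),
      ← Complex.exp_add, ← Complex.ofReal_log (by positivity), ← Complex.ofReal_log hρ.le, hlog, hu]
    congr 1
    push_cast
    ring
  have hun : ‖u‖ ≤ 3 / 2 * x := by
    rw [hu, norm_mul, norm_div, Complex.norm_real, Real.norm_of_nonneg hl0]
    simp only [Complex.norm_ofNat]
    nlinarith [norm_nonneg s]
  have hexp := Complex.norm_exp_sub_one_le (x := u) (by linarith)
  have hN : ‖(ρ : ℂ) ^ s‖ * ρ ^ 2 ≤ 1 := by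
    rw [Complex.norm_cpow_eq_rpow_re_of_pos hρ, ← Real.rpow_natCast, ← Real.rpow_add hρ]
    apply Real.rpow_le_one hρ.le hρ1
    push_cast; linarith
  have : (ρ : ℂ) ^ s * Complex.exp u * (S : ℂ) - (ρ : ℂ) ^ s
      = (ρ : ℂ) ^ s * ((Complex.exp u - 1) * (S : ℂ) + ((S - 1 : ℝ) : ℂ)) := by push_cast; ring
  rw [hA, this, norm_mul]
  have h2 : ‖(Complex.exp u - 1) * (S : ℂ) + ((S - 1 : ℝ) : ℂ)‖ ≤ 7 * (C ^ 2 * ρ ^ 2) := by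
    refine (norm_add_le _ _).trans ?_
    rw [norm_mul, Complex.norm_real, Complex.norm_real, Real.norm_of_nonneg (by linarith),
      Real.norm_of_nonneg (by linarith)]
    have : ‖Complex.exp u - 1‖ * S ≤ (3 * (C ^ 2 * ρ ^ 2)) * 2 := by
      apply mul_le_mul <;> first | positivity | linarith
    linarith
  calc _ ≤ ‖(ρ : ℂ) ^ s‖ * (7 * (C ^ 2 * ρ ^ 2)) := by gcongr
    _ = 7 * C ^ 2 * (‖(ρ : ℂ) ^ s‖ * ρ ^ 2) := by ring
    _ ≤ 7 * C ^ 2 * 1 := by gcongr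
    _ = _ := by ring

/-- Theorem 4.1, residue at `s = -2`: for a surface in `ℝ³` given locally
as the graph of a smooth `f : ℝ² → ℝ` with `f(0) = 0`, `∇f(0) = 0`, the localized
pointwise Brylinski beta function
`B(s) = ∫_{ℝ²} (‖w‖² + f(w)²)^(s/2) ψ(w) √(1 + ‖∇f(w)‖²) dw`
satisfies `(s + 2)·B(s) → 2π` as `s → -2` within `{Re s > -2}`. -/
theorem brylinski_beta_surface_residue_neg_two
    (f : EuclideanSpace ℝ (Fin 2) → ℝ)
    (hf : ContDiff ℝ (⊤ : ℕ∞) f) (hf0 : f 0 = 0) (hgrad : gradient f 0 = 0)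
    (ψ : EuclideanSpace ℝ (Fin 2) → ℝ)
    (hψ : ContDiff ℝ (⊤ : ℕ∞) ψ) (hψc : HasCompactSupport ψ)
    (hψ1 : ∀ᶠ w in nhds (0 : EuclideanSpace ℝ (Fin 2)), ψ w = 1) :
    Tendsto
      (fun s : ℂ => (s + 2) * ∫ w : EuclideanSpace ℝ (Fin 2),
        (((‖w‖ ^ 2 + (f w) ^ 2 : ℝ) : ℂ) ^ (s / 2)) * (ψ w : ℂ)
          * ((Real.sqrt (1 + ‖gradient f w‖ ^ 2) : ℝ) : ℂ))
      (nhdsWithin (-2 : ℂ) {s : ℂ | -2 < s.re})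
      (nhds ((2 * Real.pi : ℝ) : ℂ)) := by
  obtain ⟨C, hC, r₁, hr₁, hloc⟩ := aux_local f hf hf0 hgrad
  obtain ⟨r₂, hr₂, hψr⟩ := Metric.eventually_nhds_iff.1 hψ1
  obtain ⟨r, hr, hr1, hrr₁, hrr₂, hrC⟩ : ∃ r > 0, r ≤ 1 ∧ r ≤ r₁ ∧ r ≤ r₂ ∧ C * r ≤ 1 / 2 := by
    refine ⟨min (min 1 (1 / (2 * C))) (min r₁ r₂), by positivity, ?_, ?_, ?_, ?_⟩
    · exact (min_le_left _ _).trans (min_le_left _ _)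
    · exact (min_le_right _ _).trans (min_le_left _ _)
    · exact (min_le_right _ _).trans (min_le_right _ _)
    · calc _ ≤ C * (1 / (2 * C)) := by
            gcongr; exact (min_le_left _ _).trans (min_le_right _ _)
        _ = 1 / 2 := by field_simp
  have hgc : Continuous (fun w => gradient f w) := by
    have := hf.continuous_fderiv (by simp)
    unfold gradient
    fun_prop
  have hfc : Continuous f := hf.continuous
  have hψcont : Continuous ψ := hψ.continuous
  set S : EuclideanSpace ℝ (Fin 2) → ℝ := fun w => Real.sqrt (1 + ‖gradient f w‖ ^ 2) with hS
  have hSc : Continuous S := by fun_prop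
  obtain ⟨P, hP⟩ : ∃ P, ∀ w, ‖ψ w * S w‖ ≤ P :=
    (hψc.mul_right (f' := S)).exists_bound_of_continuous (hψcont.mul hSc)
  have hP0 : 0 ≤ P := (norm_nonneg _).trans (hP 0)
  set F : ℂ → EuclideanSpace ℝ (Fin 2) → ℂ := fun s w =>
    (((‖w‖ ^ 2 + (f w) ^ 2 : ℝ) : ℂ) ^ (s / 2)) * (ψ w : ℂ) * ((S w : ℝ) : ℂ) with hF
  set N : ℂ → EuclideanSpace ℝ (Fin 2) → ℂ := fun s w =>
    (Set.Iio r).indicator (fun t : ℝ => (t : ℂ) ^ s) ‖w‖ with hN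
  set K : Set (EuclideanSpace ℝ (Fin 2)) := tsupport ψ ∪ Metric.closedBall 0 r with hK
  have hKc : IsCompact K := IsCompact.union hψc (isCompact_closedBall _ _)
  set M : ℝ := 7 * C ^ 2 + (r ^ 2)⁻¹ * P with hM
  have hM0 : 0 ≤ M := by positivity
  have hbound : ∀ s : ℂ, -2 < s.re → ‖s + 2‖ < 1 → ∀ w, ‖F s w - N s w‖ ≤ K.indicator (fun _ => M) w := by
    intro s hs hs' w
    have hs3 : ‖s‖ ≤ 3 := by
      have := norm_sub_le (s + 2) 2
      simp at this
      linarith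
    have hsre : s.re < -1 := by
      have := (Complex.abs_re_le_norm (s + 2)).trans_lt hs'
      rw [abs_lt] at this
      simp at this
      linarith
    have hs0 : s ≠ 0 := by rintro rfl; norm_num at hsre
    by_cases hw : ‖w‖ < r
    · have hwK : w ∈ K := Or.inr (by simpa using hw.le)
      rw [Set.indicator_of_mem hwK]
      have hψw : ψ w = 1 := hψr (by simpa using hw.trans_le hrr₂)
      simp only [hF, hN]
      rw [Set.indicator_of_mem (by exact hw), hψw]
      rcases eq_or_ne w 0 with rfl | hw0
      · simpa [hf0, hs0] using hM0
      have hwp : 0 < ‖w‖ := norm_pos_iff.2 hw0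
      obtain ⟨h1, h2⟩ := hloc w (hw.trans_le hrr₁)
      have hg2 : ‖gradient f w‖ ^ 2 ≤ C ^ 2 * ‖w‖ ^ 2 := by
        rw [← mul_pow]; gcongr
      have := aux_cmp ‖w‖ (f w) (S w) C s hwp (hw.le.trans hr1) hC
        ((by gcongr : C * ‖w‖ ≤ C * r).trans hrC) h2
        (by rw [hS]; exact Real.one_le_sqrt.2 (by nlinarith [sq_nonneg ‖gradient f w‖]))
        (by
          rw [hS]
          apply Real.sqrt_le_iff.2
          constructor
          · positivity
          · nlinarith [sq_nonneg (C ^ 2 * ‖w‖ ^ 2), sq_nonneg (C * ‖w‖)]) hs hs3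
      rw [Complex.ofReal_one, mul_one]
      refine this.trans ?_
      rw [hM]
      have : 0 ≤ (r ^ 2)⁻¹ * P := by positivity
      linarith
    · have hNw : N s w = 0 := by
        simp only [hN]
        exact Set.indicator_of_notMem (s := Set.Iio r) (by simpa using hw) _
      rw [hNw, sub_zero]
      push Not at hw
      by_cases hwψ : w ∈ tsupport ψ
      · rw [Set.indicator_of_mem (show w ∈ K from Or.inl hwψ)]
        have hT : r ^ 2 ≤ ‖w‖ ^ 2 + f w ^ 2 := by nlinarith [sq_nonneg (f w)]
        have hr2 : 0 < r ^ 2 := by positivity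
        have hA : ‖((‖w‖ ^ 2 + (f w) ^ 2 : ℝ) : ℂ) ^ (s / 2)‖ ≤ (r ^ 2)⁻¹ := by
          rw [Complex.norm_cpow_eq_rpow_re_of_pos (hr2.trans_le hT)]
          have hre : (s / 2).re = s.re / 2 := by simp
          rw [hre]
          calc _ ≤ (r ^ 2) ^ (s.re / 2) :=
                Real.rpow_le_rpow_of_nonpos hr2 hT (by linarith)
            _ ≤ (r ^ 2) ^ (-1 : ℝ) :=
                Real.rpow_le_rpow_of_exponent_ge hr2 (by nlinarith) (by linarith)
            _ = _ := Real.rpow_neg_one _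
        have hB : ‖(ψ w : ℂ) * (S w : ℂ)‖ ≤ P := by
          rw [← Complex.ofReal_mul, Complex.norm_real]; exact hP w
        simp only [hF]
        rw [mul_assoc, norm_mul]
        have := mul_le_mul hA hB (norm_nonneg _) (by positivity)
        rw [hM]
        nlinarith [sq_nonneg C]
      · have : ψ w = 0 := image_eq_zero_of_notMem_tsupport hwψ
        simp only [hF, this]
        simpa using Set.indicator_nonneg (fun _ _ => hM0) w
  have hGint : Integrable (K.indicator (fun _ => M)) (volume : Measure (EuclideanSpace ℝ (Fin 2))) :=
    (integrable_indicator_iff hKc.measurableSet).2 (integrableOn_const hKc.measure_lt_top.ne)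
  have hFm : ∀ s, Measurable (F s) := by
    intro s
    have h1 := hfc.measurable
    have h2 := hψcont.measurable
    have h3 := hSc.measurable
    simp only [hF]
    fun_prop
  have hDint : ∀ s : ℂ, -2 < s.re → ‖s + 2‖ < 1 → Integrable (fun w => F s w - N s w) := by
    intro s hs hs'
    refine hGint.mono' ?_ (Eventually.of_forall (hbound s hs hs'))
    exact (hFm s).aestronglyMeasurable.sub (aux_ball r hr s hs).1.aestronglyMeasurable
  have hev : ∀ᶠ s in nhdsWithin (-2 : ℂ) {s : ℂ | -2 < s.re}, -2 < s.re ∧ ‖s + 2‖ < 1 := by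
    refine (eventually_mem_nhdsWithin).and (eventually_nhdsWithin_of_eventually_nhds ?_)
    have hc : Continuous (fun s : ℂ => ‖s + 2‖) := by fun_prop
    exact hc.continuousAt.eventually_lt continuousAt_const (by simp)
  have heq : ∀ s : ℂ, -2 < s.re → ‖s + 2‖ < 1 →
      (s + 2) * ∫ w, F s w = 2 * Real.pi * (r : ℂ) ^ (s + 2) + (s + 2) * ∫ w, (F s w - N s w) := by
    intro s hs hs'
    obtain ⟨h1, h2⟩ := aux_ball r hr s hs
    rw [← h2, ← mul_add, ← integral_add h1 (hDint s hs hs')]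
    simp [hN]
  have hlim0 : Tendsto (fun s : ℂ => s + 2) (nhdsWithin (-2 : ℂ) {s : ℂ | -2 < s.re}) (nhds 0) := by
    have hc : Continuous (fun s : ℂ => s + 2) := by fun_prop
    have := hc.tendsto (-2)
    simp only [neg_add_cancel] at this
    exact this.mono_left nhdsWithin_le_nhds
  have hlim1 : Tendsto (fun s : ℂ => 2 * Real.pi * (r : ℂ) ^ (s + 2))
      (nhdsWithin (-2 : ℂ) {s : ℂ | -2 < s.re}) (nhds (2 * Real.pi)) := by
    have hc : Continuous (fun z : ℂ => 2 * Real.pi * (r : ℂ) ^ z) :=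
      continuous_const.mul
        (continuous_id.const_cpow (Or.inl (by exact_mod_cast hr.ne')))
    have := (hc.tendsto 0).comp hlim0
    simpa [Function.comp_def] using this
  have hlim2 : Tendsto (fun s : ℂ => (s + 2) * ∫ w, (F s w - N s w))
      (nhdsWithin (-2 : ℂ) {s : ℂ | -2 < s.re}) (nhds 0) := by
    refine hlim0.zero_mul_isBoundedUnder_le ?_
    refine isBoundedUnder_of_eventually_le (a := ∫ w, K.indicator (fun _ => M) w) ?_
    filter_upwards [hev] with s hs
    exact norm_integral_le_of_norm_le hGint (Eventually.of_forall (hbound s hs.1 hs.2))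
  have hfin := hlim1.add hlim2
  rw [add_zero] at hfin
  have hpi : ((2 * Real.pi : ℝ) : ℂ) = 2 * Real.pi := by push_cast; rfl
  rw [hpi]
  refine hfin.congr' ?_
  filter_upwards [hev] with s hs
  exact (heq s hs.1 hs.2).symm
end

section
/- Let f : ℝ² → ℝ be a C^∞ function with f(0) = 0 and ∇f(0) = 0, and let ψ : ℝ² → ℝ be a C^∞ compactly supported function with ψ ≡ 1 on a neighborhood of 0. For Re s > -2 define B(s) = ∫_{ℝ²} (‖w‖² + f(w)²)^{s/2} ψ(w) √(1 + ‖∇f(w)‖²) dw. Set b₁ = (1/2)∂²f/∂x²(0), b₂ = ∂²f/∂x∂y(0), b₃ = (1/2)∂²f/∂y²(0). Then there exists a function F : ℂ → ℂ with F(s) = B(s) for Re s > -2, F complex differentiable at every point of {s : Re s > -5} \ {−2, −4}, and such that the limit as s → −4 of (s + 4)·F(s) exists and equals (π/2)·(b₁² + b₂² + b₃² − 2b₁b₃). -/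
open MeasureTheory Complex Filter

abbrev E2 := EuclideanSpace ℝ (Fin 2)

lemma holo_param {X : Type*} [MeasurableSpace X] {μ : Measure X} (h : ℂ → X → ℂ) (s0 : ℂ)
    (ρ : ℝ) (hρ : 0 < ρ) (g : X → ℝ) (hg : Integrable g μ)
    (hm : ∀ s, AEStronglyMeasurable (h s) μ)
    (hd : ∀ᵐ w ∂μ, Differentiable ℂ (fun s => h s w))
    (hb : ∀ᵐ w ∂μ, ∀ s ∈ Metric.closedBall s0 (2 * ρ), ‖h s w‖ ≤ g w) :
    DifferentiableAt ℂ (fun s => ∫ w, h s w ∂μ) s0 := by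
  have hint : Integrable (h s0) μ := by
    refine hg.mono' (hm s0) ?_
    filter_upwards [hb] with w hw
    exact hw s0 (Metric.mem_closedBall_self (by positivity))
  have key := hasDerivAt_integral_of_dominated_loc_of_deriv_le (𝕜 := ℂ) (μ := μ)
    (F := h) (x₀ := s0) (s := Metric.ball s0 ρ) (bound := fun w => g w / ρ)
    (F' := fun s w => deriv (fun z => h z w) s) (Metric.ball_mem_nhds _ hρ)
    (Eventually.of_forall hm) hint ?_ ?_ (hg.div_const ρ) ?_
  · exact key.2.differentiableAt
  · -- measurability of the derivative
    let ε : ℕ → ℂ := fun n => ((1 / ((n : ℝ) + 1) : ℝ) : ℂ)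
    have hε : Tendsto ε atTop (nhds 0) := by
      have := (Complex.continuous_ofReal.tendsto 0).comp tendsto_one_div_add_atTop_nhds_zero_nat
      simpa [ε, Function.comp_def] using this
    have hε0 : ∀ n, ε n ≠ 0 := by
      intro n
      simp only [ε]
      exact_mod_cast (by positivity : (1 / ((n : ℝ) + 1)) ≠ 0)
    refine aestronglyMeasurable_of_tendsto_ae (u := atTop)
      (f := fun (n : ℕ) w => (ε n)⁻¹ • (h (s0 + ε n) w - h s0 w)) ?_ ?_
    · intro n
      exact ((hm (s0 + ε n)).sub (hm s0)).const_smul ((ε n)⁻¹)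
    · filter_upwards [hd] with w hw
      have h1 := (hw s0).hasDerivAt.tendsto_slope_zero
      refine h1.comp (tendsto_nhdsWithin_iff.2 ⟨hε, Eventually.of_forall hε0⟩)
  · filter_upwards [hb, hd] with w hw hdw s hs
    refine Complex.norm_deriv_le_of_forall_mem_sphere_norm_le hρ hdw.diffContOnCl ?_
    intro z hz
    refine hw z ?_
    rw [Metric.mem_closedBall]
    rw [mem_sphere_iff_norm, ← dist_eq_norm] at hz
    have := Metric.mem_ball.1 hs
    linarith [dist_triangle z s s0]
  · filter_upwards [hd] with w hdw s _
    exact (hdw s).hasDerivAt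

lemma radial_integrable (x : ℝ) (hx : -2 < x) (R : ℝ) (hR : 0 < R) :
    IntegrableOn (fun w : E2 => ‖w‖ ^ x) (Metric.ball 0 R) := by
  rw [integrableOn_fun_norm_addHaar volume (f := fun r => r ^ x)]
  have h2 : IntegrableOn (fun y : ℝ => y ^ (x + 1)) (Set.Ioo 0 R) := by
    rw [intervalIntegral.integrableOn_Ioo_rpow_iff hR]; linarith
  refine h2.congr_fun ?_ measurableSet_Ioo
  intro y hy
  simp [Real.rpow_add hy.1, mul_comm]

lemma polar_E2 (g : E2 → ℂ) :
    ∫ w, g w = ∫ p in Set.Ioi (0:ℝ) ×ˢ Set.Ioo (-Real.pi) Real.pi,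
      (p.1 : ℂ) * g (!₂[p.1 * Real.cos p.2, p.1 * Real.sin p.2]) := by
  rw [← (PiLp.volume_preserving_toLp (Fin 2)).integral_comp
    (MeasurableEquiv.toLp 2 (Fin 2 → ℝ)).measurableEmbedding,
    ← (volume_preserving_finTwoArrow ℝ).symm.integral_comp
    (MeasurableEquiv.finTwoArrow (α := ℝ)).symm.measurableEmbedding,
    ← integral_comp_polarCoord_symm]
  rfl

lemma polar_int (s : ℂ) (P : E2 → ℝ) (T : ℝ → ℝ) (k : ℕ)
    (hP : ∀ r θ : ℝ, 0 < r → P !₂[r * Real.cos θ, r * Real.sin θ] = r ^ k * T θ)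
    (hs : -2 < s.re + k) :
    ∫ w : E2, (Metric.ball (0 : E2) 1).indicator (fun w => (‖w‖ : ℂ) ^ s * (P w : ℂ)) w
      = ((∫ θ in (-Real.pi)..Real.pi, T θ : ℝ) : ℂ) / (s + k + 2) := by
  rw [polar_E2]
  have hn : ∀ r θ : ℝ, 0 < r → ‖(!₂[r * Real.cos θ, r * Real.sin θ] : E2)‖ = r := by
    intro r θ hr
    rw [EuclideanSpace.norm_eq]
    simp only [Fin.sum_univ_two, Real.norm_eq_abs, sq_abs]
    rw [Real.sqrt_eq_iff_mul_self_eq (by positivity) hr.le]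
    simp
    nlinarith [Real.sin_sq_add_cos_sq θ]
  have e1 : ∫ p in Set.Ioi (0:ℝ) ×ˢ Set.Ioo (-Real.pi) Real.pi,
      (p.1 : ℂ) * (Metric.ball (0 : E2) 1).indicator (fun w => (‖w‖ : ℂ) ^ s * (P w : ℂ))
        (!₂[p.1 * Real.cos p.2, p.1 * Real.sin p.2])
      = ∫ p in Set.Ioi (0:ℝ) ×ˢ Set.Ioo (-Real.pi) Real.pi,
        (Set.Iio (1:ℝ)).indicator (fun r : ℝ => (r : ℂ) ^ (s + k + 1)) p.1 * ((T p.2 : ℝ) : ℂ) := by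
    refine setIntegral_congr_fun (measurableSet_Ioi.prod measurableSet_Ioo) ?_
    rintro ⟨r, θ⟩ ⟨hr, hθ⟩
    have hr' : 0 < r := hr
    have hr0 : (r : ℂ) ≠ 0 := by exact_mod_cast hr'.ne'
    have h1 := hn r θ hr'
    have h2 := hP r θ hr'
    dsimp only
    generalize (!₂[r * Real.cos θ, r * Real.sin θ] : E2) = v at h1 h2
    by_cases hlt : r < 1
    · have hm : v ∈ Metric.ball (0 : E2) 1 := mem_ball_zero_iff.2 (h1.trans_lt hlt)
      rw [Set.indicator_of_mem hm, Set.indicator_of_mem (show r ∈ Set.Iio (1:ℝ) from hlt)]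
      rw [cpow_add _ _ hr0, cpow_add _ _ hr0, cpow_natCast, cpow_one, h2]
      erw [h1]
      push_cast; ring
    · have hm : v ∉ Metric.ball (0 : E2) 1 := fun h => hlt (h1.symm.trans_lt (mem_ball_zero_iff.1 h))
      rw [Set.indicator_of_notMem hm, Set.indicator_of_notMem (show r ∉ Set.Iio (1:ℝ) from hlt)]
      simp
  rw [e1, Measure.volume_eq_prod, setIntegral_prod_mul
    ((Set.Iio (1:ℝ)).indicator (fun r : ℝ => (r : ℂ) ^ (s + k + 1)))
    (fun θ => ((T θ : ℝ) : ℂ)), setIntegral_indicator measurableSet_Iio]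
  have e2 : ∫ r in Set.Ioi (0:ℝ) ∩ Set.Iio 1, (r : ℂ) ^ (s + k + 1) = 1 / (s + k + 2) := by
    rw [Set.Ioi_inter_Iio, ← integral_Ioc_eq_integral_Ioo,
      ← intervalIntegral.integral_of_le zero_le_one, integral_cpow (Or.inl (by simp; linarith))]
    have : s + k + 1 + 1 ≠ 0 := by
      intro h
      have := congrArg Complex.re h
      simp at this
      linarith
    rw [ofReal_one, one_cpow, ofReal_zero, zero_cpow this, sub_zero]
    ring
  rw [e2, ← integral_Ioc_eq_integral_Ioo,
    ← intervalIntegral.integral_of_le (by linarith [Real.pi_pos]),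
    intervalIntegral.integral_ofReal]
  ring

lemma cpow_taylor (A S : ℝ) (hA : 0 ≤ A) : ∃ C : ℝ, 0 ≤ C ∧ ∀ (z : ℂ), ‖z‖ ≤ S → ∀ a : ℝ, 0 ≤ a → a ≤ A →
    ‖((1 + a : ℝ) : ℂ) ^ z - 1 - z * a‖ ≤ C * a ^ 2 := by
  by_cases hS : 0 ≤ S
  swap
  · exact ⟨0, le_rfl, fun z hz => absurd ((norm_nonneg z).trans hz) hS⟩
  set B := (1 + A) ^ S with hB
  have hB0 : 0 ≤ B := by positivity
  refine ⟨S * ((S + 1) * B), by positivity, ?_⟩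
  intro z hz a ha haA
  have hder : ∀ (c : ℂ) (t : ℝ), 0 ≤ t →
      HasDerivAt (fun t : ℝ => ((1 + t : ℝ) : ℂ) ^ c) (c * ((1 + t : ℝ) : ℂ) ^ (c - 1)) t := by
    intro c t ht
    have h1 : HasDerivAt (fun u : ℂ => 1 + u) 1 (t : ℂ) := (hasDerivAt_id (t : ℂ)).const_add 1
    have h2 := (h1.cpow_const (c := c) (Or.inl (by simp; linarith))).comp_ofReal
    simpa using h2
  have step1 : ∀ t : ℝ, 0 ≤ t → t ≤ a → ‖((1 + t : ℝ) : ℂ) ^ (z - 1) - 1‖ ≤ (S + 1) * B * a := by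
    intro t ht hta
    have := Convex.norm_image_sub_le_of_norm_hasDerivWithin_le (s := Set.Icc 0 a)
      (f := fun t : ℝ => ((1 + t : ℝ) : ℂ) ^ (z - 1)) (C := (S + 1) * B)
      (fun x hx => (hder (z - 1) x hx.1).hasDerivWithinAt) ?_ (convex_Icc 0 a)
      (x := 0) (y := t) ⟨le_rfl, ha⟩ ⟨ht, hta⟩
    · simp only [add_zero, ofReal_one, one_cpow, sub_zero, Real.norm_eq_abs, abs_of_nonneg ht] at this
      refine this.trans ?_
      gcongr
    · intro x hx
      have hx0 : 0 < 1 + x := by linarith [hx.1]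
      rw [norm_mul, norm_cpow_eq_rpow_re_of_pos hx0]
      gcongr
      · calc ‖z - 1‖ ≤ ‖z‖ + ‖(1:ℂ)‖ := norm_sub_le _ _
          _ ≤ S + 1 := by simpa using hz
      · calc (1 + x) ^ (z - 1 - 1).re ≤ (1 + x) ^ S := by
              refine Real.rpow_le_rpow_of_exponent_le (by linarith [hx.1]) ?_
              have := (Complex.re_le_norm z)
              simp; linarith
          _ ≤ B := Real.rpow_le_rpow hx0.le (by linarith [hx.2]) hS
  have := Convex.norm_image_sub_le_of_norm_hasDerivWithin_le (s := Set.Icc 0 a)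
      (f := fun t : ℝ => ((1 + t : ℝ) : ℂ) ^ z - z * t) (C := S * ((S + 1) * B * a))
      (f' := fun t => z * ((1 + t : ℝ) : ℂ) ^ (z - 1) - z * 1)
      (fun x hx => (((hder z x hx.1)).sub
        ((hasDerivAt_id x).ofReal_comp.const_mul z)).hasDerivWithinAt) ?_ (convex_Icc 0 a)
      (x := 0) (y := a) ⟨le_rfl, ha⟩ ⟨ha, le_rfl⟩
  · simp only [add_zero, ofReal_one, one_cpow, ofReal_zero, mul_zero, sub_zero, Real.norm_eq_abs,
      abs_of_nonneg ha] at this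
    calc _ = ‖((1 + a : ℝ) : ℂ) ^ z - z * a - 1‖ := by congr 1; ring
      _ ≤ _ := this
      _ = _ := by ring
  · intro x hx
    rw [← mul_sub, norm_mul]
    gcongr
    exact step1 x hx.1 hx.2

def BO (R : ℝ) (k : ℕ) (g : E2 → ℝ) : Prop :=
  ∃ C : ℝ, 0 ≤ C ∧ ∀ w : E2, ‖w‖ < R → |g w| ≤ C * ‖w‖ ^ k

noncomputable def chi (w : E2) : ℝ := (Metric.ball (0 : E2) 1).indicator (fun _ => (1 : ℝ)) w

noncomputable def KK (a u a0 p0 : E2 → ℝ) (s : ℂ) (w : E2) : ℂ :=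
  ((1 + a w : ℝ) : ℂ) ^ (s / 2) * (u w : ℂ)
    - (chi w : ℂ) * (1 + (s / 2) * (a0 w : ℂ) + (p0 w : ℂ) / 2)

lemma measurable_chi : Measurable chi :=
  measurable_const.indicator measurableSet_ball

lemma KK_bound {R : ℝ} (hR : 1 ≤ R) (a u a0 p0 : E2 → ℝ) (ha : ∀ w, 0 ≤ a w)
    (hBa : BO R 2 a) (hBu : BO R 0 u)
    (hB1 : BO R 3 (fun w => u w - chi w * (1 + p0 w / 2)))
    (hB2 : BO R 3 (fun w => a w * u w - chi w * a0 w)) (S : ℝ) (hS : 0 ≤ S) :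
    ∃ C : ℝ, 0 ≤ C ∧ ∀ s : ℂ, ‖s‖ ≤ S → ∀ w : E2, ‖w‖ < R →
      ‖KK a u a0 p0 s w‖ ≤ C * ‖w‖ ^ 3 := by
  obtain ⟨Ca, hCa, hBa⟩ := hBa
  obtain ⟨Cu, hCu, hBu⟩ := hBu
  obtain ⟨C1, hC1, hB1⟩ := hB1
  obtain ⟨C2, hC2, hB2⟩ := hB2
  obtain ⟨Ct, hCt, ht⟩ := cpow_taylor (Ca * R ^ 2) S (by positivity)
  refine ⟨Ct * (Ca ^ 2 * R) * Cu + C1 + S * C2, by positivity, ?_⟩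
  intro s hs w hw
  have hz : ‖s / 2‖ ≤ S := by
    rw [norm_div]
    simp only [Complex.norm_ofNat]
    linarith [norm_nonneg s]
  have haw : a w ≤ Ca * ‖w‖ ^ 2 := (le_abs_self _).trans (hBa w hw)
  have haR : a w ≤ Ca * R ^ 2 := haw.trans (by gcongr)
  have e : KK a u a0 p0 s w = (((1 + a w : ℝ) : ℂ) ^ (s / 2) - 1 - (s / 2) * (a w : ℂ)) * (u w : ℂ)
      + ((u w - chi w * (1 + p0 w / 2) : ℝ) : ℂ)
      + (s / 2) * ((a w * u w - chi w * a0 w : ℝ) : ℂ) := by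
    rw [KK]; push_cast; ring
  rw [e]
  refine (norm_add₃_le).trans ?_
  rw [norm_mul, norm_mul, Complex.norm_real, Complex.norm_real, Complex.norm_real,
    Real.norm_eq_abs, Real.norm_eq_abs, Real.norm_eq_abs]
  have t1 := ht (s / 2) hz (a w) (ha w) haR
  have t2 := hBu w hw
  have t3 := hB1 w hw
  have t4 := hB2 w hw
  have t5 : a w ^ 2 ≤ Ca ^ 2 * R * ‖w‖ ^ 3 := by
    calc a w ^ 2 ≤ (Ca * ‖w‖ ^ 2) ^ 2 := by gcongr; exact ha w
      _ = Ca ^ 2 * ‖w‖ * ‖w‖ ^ 3 := by ring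
      _ ≤ _ := by gcongr
  calc _ ≤ Ct * (Ca ^ 2 * R * ‖w‖ ^ 3) * (Cu * ‖w‖ ^ 0) + C1 * ‖w‖ ^ 3 + S * (C2 * ‖w‖ ^ 3) := by
        gcongr
        exact t1.trans (by gcongr)
    _ = _ := by ring

lemma ae_ne_zero_E2 : ∀ᵐ w : E2, w ≠ 0 := by
  simp [ae_iff]

lemma measurable_KK (a u a0 p0 : E2 → ℝ) (hma : Measurable a) (hmu : Measurable u)
    (hma0 : Measurable a0) (hmp0 : Measurable p0) (s : ℂ) :
    Measurable (fun w : E2 => ((‖w‖ : ℝ) : ℂ) ^ s * KK a u a0 p0 s w) := by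
  unfold KK
  have := measurable_chi
  fun_prop

lemma h_bound {R : ℝ} (hR : 1 ≤ R) (a u a0 p0 : E2 → ℝ) (ha : ∀ w, 0 ≤ a w)
    (hBa : BO R 2 a) (hBu : BO R 0 u)
    (hB1 : BO R 3 (fun w => u w - chi w * (1 + p0 w / 2)))
    (hB2 : BO R 3 (fun w => a w * u w - chi w * a0 w))
    (hu0 : ∀ w, R ≤ ‖w‖ → u w = 0) (S σ τ : ℝ) (hS : 0 ≤ S) (hσ : -5 < σ) (hστ : σ ≤ τ) :
    ∃ g : E2 → ℝ, Integrable g ∧ ∀ w : E2, w ≠ 0 → ∀ s : ℂ, ‖s‖ ≤ S → σ ≤ s.re → s.re ≤ τ →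
      ‖((‖w‖ : ℝ) : ℂ) ^ s * KK a u a0 p0 s w‖ ≤ g w := by
  obtain ⟨C, hC, hK⟩ := KK_bound hR a u a0 p0 ha hBa hBu hB1 hB2 S hS
  refine ⟨(Metric.ball (0 : E2) R).indicator
    (fun w => C * (‖w‖ ^ (σ + 3) + ‖w‖ ^ (τ + 3))), ?_, ?_⟩
  · rw [integrable_indicator_iff measurableSet_ball]
    exact ((radial_integrable _ (by linarith) R (by linarith)).add
      (radial_integrable _ (by linarith) R (by linarith))).const_mul C
  · intro w hw0 s hs h1 h2
    have hpos : 0 < ‖w‖ := norm_pos_iff.2 hw0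
    by_cases hw : ‖w‖ < R
    · rw [Set.indicator_of_mem (mem_ball_zero_iff.2 hw), norm_mul,
        norm_cpow_eq_rpow_re_of_pos hpos]
      have e1 : ‖w‖ ^ s.re ≤ ‖w‖ ^ σ + ‖w‖ ^ τ := by
        rcases le_total ‖w‖ 1 with h | h
        · have := Real.rpow_le_rpow_of_exponent_ge hpos h h1
          have : 0 ≤ ‖w‖ ^ τ := by positivity
          linarith
        · have := Real.rpow_le_rpow_of_exponent_le h h2
          have : 0 ≤ ‖w‖ ^ σ := by positivity
          linarith
      have e3 : ∀ x : ℝ, ‖w‖ ^ (x + 3) = ‖w‖ ^ x * ‖w‖ ^ 3 := by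
        intro x
        rw [Real.rpow_add hpos]
        norm_cast
      calc _ ≤ (‖w‖ ^ σ + ‖w‖ ^ τ) * (C * ‖w‖ ^ 3) := by
            gcongr
            exact hK s hs w hw
        _ = _ := by rw [e3, e3]; ring
    · have hw' := not_lt.1 hw
      have hb : w ∉ Metric.ball (0 : E2) 1 := by
        rw [mem_ball_zero_iff]; linarith
      rw [Set.indicator_of_notMem (by rwa [mem_ball_zero_iff])]
      simp [KK, hu0 w hw', chi, hb]

lemma main_integrable (s : ℂ) (P : E2 → ℝ) (hP : Measurable P) (k : ℕ) (hs : -2 < s.re + k)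
    (hB : BO 1 k P) :
    Integrable ((Metric.ball (0 : E2) 1).indicator
      (fun w => (‖w‖ : ℂ) ^ s * (P w : ℂ))) := by
  obtain ⟨C, hC, hB⟩ := hB
  rw [integrable_indicator_iff measurableSet_ball]
  have h1 := (radial_integrable (s.re + k) hs 1 one_pos).const_mul C
  refine Integrable.mono' h1 ?_ ?_
  · refine Measurable.aestronglyMeasurable ?_
    fun_prop
  · filter_upwards [ae_restrict_mem measurableSet_ball, ae_restrict_of_ae ae_ne_zero_E2] with w hw hw0
    have hpos : 0 < ‖w‖ := norm_pos_iff.2 hw0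
    rw [norm_mul, norm_cpow_eq_rpow_re_of_pos hpos, Complex.norm_real, Real.norm_eq_abs,
      Real.rpow_add hpos, Real.rpow_natCast]
    have := hB w (mem_ball_zero_iff.1 hw)
    calc _ ≤ ‖w‖ ^ s.re * (C * ‖w‖ ^ k) := by gcongr
      _ = _ := by ring

lemma BO.restrict {R : ℝ} (hR : 1 ≤ R) {k : ℕ} {g : E2 → ℝ} (h : BO R k g) : BO 1 k g := by
  obtain ⟨C, hC, h⟩ := h
  exact ⟨C, hC, fun w hw => h w (hw.trans_le hR)⟩

lemma abstract_cont {R : ℝ} (hR : 1 ≤ R) (a u a0 p0 : E2 → ℝ) (ha : ∀ w, 0 ≤ a w)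
    (hma : Measurable a) (hmu : Measurable u)
    (hma0 : Measurable a0) (hmp0 : Measurable p0)
    (hBa : BO R 2 a) (hBu : BO R 0 u) (hBa0 : BO R 2 a0) (hBp0 : BO R 2 p0)
    (hB1 : BO R 3 (fun w => u w - chi w * (1 + p0 w / 2)))
    (hB2 : BO R 3 (fun w => a w * u w - chi w * a0 w))
    (hu0 : ∀ w, R ≤ ‖w‖ → u w = 0) (Ta Tp : ℝ → ℝ) (A C : ℝ)
    (hTa : ∀ r θ : ℝ, 0 < r → a0 !₂[r * Real.cos θ, r * Real.sin θ] = r ^ 2 * Ta θ)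
    (hTp : ∀ r θ : ℝ, 0 < r → p0 !₂[r * Real.cos θ, r * Real.sin θ] = r ^ 2 * Tp θ)
    (hA : ∫ θ in (-Real.pi)..Real.pi, Ta θ = A) (hC : ∫ θ in (-Real.pi)..Real.pi, Tp θ = C) :
    ∃ F : ℂ → ℂ,
      (∀ s : ℂ, -2 < s.re →
        F s = ∫ w : E2, ((‖w‖ : ℝ) : ℂ) ^ s * (((1 + a w : ℝ) : ℂ) ^ (s / 2) * (u w : ℂ))) ∧
      (∀ s : ℂ, -5 < s.re → s ≠ -2 → s ≠ -4 → DifferentiableAt ℂ F s) ∧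
      Tendsto (fun s : ℂ => (s + 4) * F s) (nhdsWithin (-4 : ℂ) {(-4 : ℂ)}ᶜ)
        (nhds ((-2 * A + C / 2 : ℝ) : ℂ)) := by
  set H : ℂ → ℂ := fun s => ∫ w : E2, ((‖w‖ : ℝ) : ℂ) ^ s * KK a u a0 p0 s w with hH
  have hHd : ∀ s : ℂ, -5 < s.re → DifferentiableAt ℂ H s := by
    intro s0 hs0
    set ρ := (s0.re + 5) / 4 with hρ
    have hρ0 : 0 < ρ := by rw [hρ]; linarith
    obtain ⟨g, hg, hgb⟩ := h_bound hR a u a0 p0 ha hBa hBu hB1 hB2 hu0 (‖s0‖ + 2 * ρ)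
      (s0.re - 2 * ρ) (s0.re + 2 * ρ) (by positivity) (by rw [hρ]; linarith) (by linarith)
    refine holo_param (fun s w => ((‖w‖ : ℝ) : ℂ) ^ s * KK a u a0 p0 s w) s0 ρ hρ0 g hg
      (fun s => (measurable_KK a u a0 p0 hma hmu hma0 hmp0 s).aestronglyMeasurable) ?_ ?_
    · filter_upwards [ae_ne_zero_E2] with w hw s
      have h1 : ((‖w‖ : ℝ) : ℂ) ≠ 0 := by exact_mod_cast (norm_pos_iff.2 hw).ne'
      have h2 : ((1 + a w : ℝ) : ℂ) ≠ 0 := by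
        have := ha w
        exact_mod_cast (by linarith : (0:ℝ) < 1 + a w).ne'
      unfold KK
      have d1 : DifferentiableAt ℂ (fun s : ℂ => ((‖w‖ : ℝ) : ℂ) ^ s) s :=
        differentiableAt_id.const_cpow (Or.inl h1)
      have d2 : DifferentiableAt ℂ (fun s : ℂ => ((1 + a w : ℝ) : ℂ) ^ (s / 2)) s :=
        (differentiableAt_id.div_const 2).const_cpow (Or.inl h2)
      fun_prop
    · filter_upwards [ae_ne_zero_E2] with w hw s hs
      rw [mem_closedBall_iff_norm] at hs
      have h1 := (Complex.abs_re_le_norm (s - s0)).trans hs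
      rw [abs_le, Complex.sub_re] at h1
      refine hgb w hw s ?_ (by linarith) (by linarith)
      calc ‖s‖ = ‖s0 + (s - s0)‖ := by congr 1; ring
        _ ≤ ‖s0‖ + ‖s - s0‖ := norm_add_le _ _
        _ ≤ _ := by linarith
  refine ⟨fun s => H s + 2 * Real.pi / (s + 2) + ((s / 2) * A + C / 2) / (s + 4), ?_, ?_, ?_⟩
  · intro s hs
    obtain ⟨g, hg, hgb⟩ := h_bound hR a u a0 p0 ha hBa hBu hB1 hB2 hu0 ‖s‖
      s.re s.re (norm_nonneg _) (by linarith) le_rfl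
    have hi : Integrable (fun w : E2 => ((‖w‖ : ℝ) : ℂ) ^ s * KK a u a0 p0 s w) := by
      refine hg.mono' (measurable_KK a u a0 p0 hma hmu hma0 hmp0 s).aestronglyMeasurable ?_
      filter_upwards [ae_ne_zero_E2] with w hw
      exact hgb w hw s le_rfl le_rfl le_rfl
    have hB0 : BO 1 0 (fun _ => (1:ℝ)) := ⟨1, zero_le_one, fun w _ => by simp⟩
    have i0 := main_integrable s (fun _ => 1) measurable_const 0 (by simpa using hs) hB0
    have i1 := main_integrable s a0 hma0 2 (by simp; linarith) (hBa0.restrict hR)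
    have i2 := main_integrable s p0 hmp0 2 (by simp; linarith) (hBp0.restrict hR)
    have v0 := polar_int s (fun _ => 1) (fun _ => 1) 0 (by simp) (by simpa using hs)
    have v1 := polar_int s a0 Ta 2 hTa (by simp; linarith)
    have v2 := polar_int s p0 Tp 2 hTp (by simp; linarith)
    rw [hA] at v1
    rw [hC] at v2
    have hsum : ∫ w : E2, ((‖w‖ : ℝ) : ℂ) ^ s * (((1 + a w : ℝ) : ℂ) ^ (s / 2) * (u w : ℂ))
        = H s + ((∫ w : E2, (Metric.ball (0 : E2) 1).indicator
            (fun w => (‖w‖ : ℂ) ^ s * (((1:ℝ) : ℝ) : ℂ)) w)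
          + (s / 2) * (∫ w : E2, (Metric.ball (0 : E2) 1).indicator
            (fun w => (‖w‖ : ℂ) ^ s * (a0 w : ℂ)) w)
          + (1 / 2) * (∫ w : E2, (Metric.ball (0 : E2) 1).indicator
            (fun w => (‖w‖ : ℂ) ^ s * (p0 w : ℂ)) w)) := by
      have i1' := i1.const_mul (s / 2)
      have i2' := i2.const_mul (1 / 2)
      have j1 := i0.add i1'
      have j2 := j1.add i2'
      rw [← integral_const_mul, ← integral_const_mul, ← integral_add i0 i1']
      refine Eq.trans ?_ (congrArg (H s + ·) (integral_add j1 i2'))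
      refine Eq.trans ?_ (integral_add hi j2)
      refine integral_congr_ae (Eventually.of_forall fun w => ?_)
      by_cases hw : w ∈ Metric.ball (0 : E2) 1
      · simp only [KK, chi, Set.indicator_of_mem hw]
        push_cast
        ring
      · simp only [KK, chi, Set.indicator_of_notMem hw]
        push_cast
        ring
    rw [hsum, v0, v1, v2]
    have n2 : s + 2 ≠ 0 := by
      intro h
      have := congrArg Complex.re h
      simp at this; linarith
    have n4 : s + 2 + 2 ≠ 0 := by
      intro h
      have := congrArg Complex.re h
      simp at this; linarith
    have e4 : s + 4 = s + 2 + 2 := by ring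
    simp only [e4]
    simp only [intervalIntegral.integral_const, smul_eq_mul]
    push_cast
    rw [add_zero]
    field_simp
    ring
  · intro s hs h2 h4
    have n2 : s + 2 ≠ 0 := fun h => h2 (eq_neg_of_add_eq_zero_left h)
    have n4 : s + 4 ≠ 0 := fun h => h4 (eq_neg_of_add_eq_zero_left h)
    have := hHd s hs
    fun_prop (disch := assumption)
  · have hc : ContinuousAt H (-4) := (hHd (-4) (by norm_num)).continuousAt
    have hlim : Tendsto (fun s : ℂ => (s + 4) * (H s + 2 * Real.pi / (s + 2)) + ((s / 2) * A + C / 2))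
        (nhds (-4)) (nhds (((-4:ℂ) + 4) * (H (-4) + 2 * Real.pi / ((-4) + 2)) + (((-4) / 2) * A + C / 2))) := by
      have : ContinuousAt (fun s : ℂ => (s + 4) * (H s + 2 * Real.pi / (s + 2)) + ((s / 2) * A + C / 2)) (-4) := by
        have n2 : (-4 : ℂ) + 2 ≠ 0 := by norm_num
        fun_prop (disch := assumption)
      exact this.tendsto
    have hval : (((-4:ℂ) + 4) * (H (-4) + 2 * Real.pi / ((-4) + 2)) + (((-4) / 2) * A + C / 2))
        = ((-2 * A + C / 2 : ℝ) : ℂ) := by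
      push_cast
      ring
    rw [hval] at hlim
    refine (hlim.mono_left nhdsWithin_le_nhds).congr' ?_
    filter_upwards [self_mem_nhdsWithin] with s hs
    have n4 : s + 4 ≠ 0 := fun h => hs (eq_neg_of_add_eq_zero_left h)
    field_simp

lemma BO.add {R : ℝ} {k : ℕ} {g h : E2 → ℝ} (hg : BO R k g) (hh : BO R k h) :
    BO R k (fun w => g w + h w) := by
  obtain ⟨C, hC, hg⟩ := hg
  obtain ⟨C', hC', hh⟩ := hh
  refine ⟨C + C', by positivity, fun w hw => ?_⟩
  calc _ ≤ |g w| + |h w| := abs_add_le _ _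
    _ ≤ C * ‖w‖ ^ k + C' * ‖w‖ ^ k := add_le_add (hg w hw) (hh w hw)
    _ = _ := by ring

lemma BO.mul {R : ℝ} {k l : ℕ} {g h : E2 → ℝ} (hg : BO R k g) (hh : BO R l h) :
    BO R (k + l) (fun w => g w * h w) := by
  obtain ⟨C, hC, hg⟩ := hg
  obtain ⟨C', hC', hh⟩ := hh
  refine ⟨C * C', by positivity, fun w hw => ?_⟩
  calc _ = |g w| * |h w| := abs_mul _ _
    _ ≤ (C * ‖w‖ ^ k) * (C' * ‖w‖ ^ l) :=
      mul_le_mul (hg w hw) (hh w hw) (abs_nonneg _) (by positivity)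
    _ = _ := by ring

lemma BO.const_mul {R : ℝ} {k : ℕ} {g : E2 → ℝ} (hg : BO R k g) (c : ℝ) :
    BO R k (fun w => c * g w) := by
  obtain ⟨C, hC, hg⟩ := hg
  refine ⟨|c| * C, by positivity, fun w hw => ?_⟩
  rw [abs_mul, mul_assoc]
  exact mul_le_mul_of_nonneg_left (hg w hw) (abs_nonneg _)

lemma BO.mono {R : ℝ} {k l : ℕ} (hkl : k ≤ l) {g : E2 → ℝ} (hR : 0 ≤ R) (hg : BO R l g) :
    BO R k g := by
  obtain ⟨C, hC, hg⟩ := hg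
  refine ⟨C * R ^ (l - k), by positivity, fun w hw => (hg w hw).trans ?_⟩
  calc C * ‖w‖ ^ l = C * ‖w‖ ^ (l - k) * ‖w‖ ^ k := by
        rw [mul_assoc, ← pow_add, Nat.sub_add_cancel hkl]
    _ ≤ _ := by gcongr

lemma BO.congr {R : ℝ} {k : ℕ} {g h : E2 → ℝ} (hg : BO R k g) (e : ∀ w, h w = g w) : BO R k h := by
  have : h = g := funext e
  rwa [this]

lemma BO.of_abs_le {R : ℝ} {k : ℕ} {g h : E2 → ℝ} (hg : BO R k g) (e : ∀ w, |h w| ≤ |g w|) :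
    BO R k h := by
  obtain ⟨C, hC, hg⟩ := hg
  exact ⟨C, hC, fun w hw => (e w).trans (hg w hw)⟩

lemma BO.div_sq {R : ℝ} {k : ℕ} {g : E2 → ℝ} (hg : BO R (k + 2) g) :
    BO R k (fun w => g w / ‖w‖ ^ 2) := by
  obtain ⟨C, hC, hg⟩ := hg
  refine ⟨C, hC, fun w hw => ?_⟩
  by_cases h0 : w = 0
  · subst h0; simp; positivity
  have hpos : 0 < ‖w‖ := norm_pos_iff.2 h0
  rw [abs_div, abs_of_nonneg (by positivity : 0 ≤ ‖w‖ ^ 2), div_le_iff₀ (by positivity)]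
  calc _ ≤ _ := hg w hw
    _ = _ := by ring

lemma BO.of_continuous {R : ℝ} {g : E2 → ℝ} (hg : Continuous g) : BO R 0 g := by
  obtain ⟨C, hC⟩ := (isCompact_closedBall (0 : E2) R).exists_bound_of_continuousOn hg.continuousOn
  refine ⟨|C|, abs_nonneg _, fun w hw => ?_⟩
  have := hC w (mem_closedBall_zero_iff.2 hw.le)
  simp only [pow_zero, mul_one]
  exact this.trans (le_abs_self _)

lemma BO_chi {R : ℝ} : BO R 0 chi := by
  refine ⟨1, zero_le_one, fun w _ => ?_⟩
  by_cases h : w ∈ Metric.ball (0 : E2) 1 <;> simp [chi, h]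

lemma BO_of_eventually_zero {R : ℝ} {k : ℕ} {g : E2 → ℝ} (hB : BO R 0 g)
    (h0 : ∀ᶠ w in nhds (0 : E2), g w = 0) : BO R k g := by
  obtain ⟨C, hC, hB⟩ := hB
  obtain ⟨δ, hδ, h⟩ := Metric.eventually_nhds_iff.1 h0
  refine ⟨C / δ ^ k, by positivity, fun w hw => ?_⟩
  by_cases hw' : ‖w‖ < δ
  · rw [h (by simpa using hw')]; simp; positivity
  · have h1 := hB w hw
    have h2 : δ ^ k ≤ ‖w‖ ^ k := by gcongr; exact not_lt.1 hw'
    have h3 : 1 ≤ ‖w‖ ^ k / δ ^ k := by rwa [one_le_div (by positivity)]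
    calc |g w| ≤ C * 1 := by simpa using h1
      _ ≤ C * (‖w‖ ^ k / δ ^ k) := by gcongr
      _ = _ := by ring

lemma mv_step {F : Type*} [NormedAddCommGroup F] [NormedSpace ℝ F] (g : E2 → F)
    (g' : E2 → E2 →L[ℝ] F) (hg : ∀ w, HasFDerivAt g (g' w) w) (h0 : g 0 = 0) (R C : ℝ) (hC : 0 ≤ C)
    (n : ℕ) (hb : ∀ w, ‖w‖ < R → ‖g' w‖ ≤ C * ‖w‖ ^ n) :
    ∀ w, ‖w‖ < R → ‖g w‖ ≤ C * ‖w‖ ^ (n + 1) := by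
  intro w hw
  have := Convex.norm_image_sub_le_of_norm_hasFDerivWithin_le (𝕜 := ℝ)
    (s := Metric.closedBall (0 : E2) ‖w‖) (f := g) (f' := g') (C := C * ‖w‖ ^ n)
    (fun x _ => (hg x).hasFDerivWithinAt) ?_ (convex_closedBall _ _) (x := 0) (y := w)
    (by simp) (by simp)
  · rw [h0, sub_zero, sub_zero] at this
    calc _ ≤ _ := this
      _ = _ := by ring
  · intro x hx
    rw [mem_closedBall_zero_iff] at hx
    refine (hb x (hx.trans_lt hw)).trans ?_
    gcongr

lemma bound_fderiv {F : Type*} [NormedAddCommGroup F] [NormedSpace ℝ F] (g : E2 → F)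
    (hg : ContDiff ℝ (⊤ : ℕ∞) g) (R : ℝ) :
    ∃ C : ℝ, 0 ≤ C ∧ ∀ w, ‖w‖ < R → ‖fderiv ℝ g w‖ ≤ C := by
  have h3 : Continuous (fderiv ℝ g) := hg.continuous_fderiv (by simp)
  obtain ⟨C0, hC0⟩ := (isCompact_closedBall (0 : E2) R).exists_bound_of_continuousOn
    h3.continuousOn
  exact ⟨|C0|, abs_nonneg _, fun w hw =>
    (hC0 w (mem_closedBall_zero_iff.2 hw.le)).trans (le_abs_self _)⟩

lemma taylor_f (f : E2 → ℝ) (hf : ContDiff ℝ (⊤ : ℕ∞) f) (hf0 : f 0 = 0)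
    (hd0 : fderiv ℝ f 0 = 0) (R : ℝ) :
    ∃ C : ℝ, 0 ≤ C ∧ (∀ w, ‖w‖ < R → ‖fderiv ℝ f w - fderiv ℝ (fderiv ℝ f) 0 w‖ ≤ C * ‖w‖ ^ 2) ∧
      (∀ w, ‖w‖ < R → |f w - (1 / 2) * fderiv ℝ (fderiv ℝ f) 0 w w| ≤ C * ‖w‖ ^ 3) := by
  have h1 : ContDiff ℝ (⊤ : ℕ∞) (fderiv ℝ f) := hf.fderiv_right (by simp)
  have h2 : ContDiff ℝ (⊤ : ℕ∞) (fderiv ℝ (fderiv ℝ f)) := h1.fderiv_right (by simp)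
  set D := fderiv ℝ (fderiv ℝ f) 0 with hD
  obtain ⟨C0, hC00, hC0⟩ := bound_fderiv (fderiv ℝ (fderiv ℝ f)) h2 R
  have s0 := mv_step (fun w => fderiv ℝ (fderiv ℝ f) w - D)
    (fun w => fderiv ℝ (fderiv ℝ (fderiv ℝ f)) w)
    (fun w => ((h2.differentiable (by simp)) w).hasFDerivAt.sub_const D) (by simp [hD]) R C0
    hC00 0 (fun w hw => by
      rw [pow_zero, mul_one]
      exact hC0 w hw)
  have s1 := mv_step (fun w => fderiv ℝ f w - D w) (fun w => fderiv ℝ (fderiv ℝ f) w - D)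
    (fun w => ((h1.differentiable (by simp)) w).hasFDerivAt.sub D.hasFDerivAt)
    (by simp [hd0]) R C0 hC00 1 s0
  have hsymm : ∀ v w, D v w = D w v := by
    have := (hf.contDiffAt (x := 0)).isSymmSndFDerivAt (by simp; exact WithTop.coe_le_coe.2 (le_top : (2 : ℕ∞) ≤ ⊤))
    intro v w
    exact this.eq v w
  have s2 := mv_step (fun w => f w - (1 / 2) * D w w) (fun w => fderiv ℝ f w - D w)
    (fun w => by
      have hq : HasFDerivAt (fun w => (1 / 2) * D w w) (D w) w := by
        have := (D.hasFDerivAt (x := w)).clm_apply (hasFDerivAt_id (𝕜 := ℝ) w)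
        have := this.const_mul (1 / 2 : ℝ)
        refine this.congr_fderiv ?_
        ext v
        simp [hsymm v w]
        ring
      exact ((hf.differentiable (by simp)) w).hasFDerivAt.sub hq)
    (by simp [hf0]) R C0 hC00 2 s1
  exact ⟨C0, hC00, s1, s2⟩

lemma norm_sq_dual (ℓ : E2 →L[ℝ] ℝ) :
    ‖ℓ‖ ^ 2 = (ℓ (EuclideanSpace.single 0 1)) ^ 2 + (ℓ (EuclideanSpace.single 1 1)) ^ 2 := by
  have h1 : ‖ℓ‖ = ‖(InnerProductSpace.toDual ℝ E2).symm ℓ‖ := by simp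
  have h2 : ∀ i, (InnerProductSpace.toDual ℝ E2).symm ℓ i = ℓ (EuclideanSpace.single i 1) := by
    intro i
    rw [← InnerProductSpace.toDual_symm_apply (𝕜 := ℝ) (y := ℓ),
      EuclideanSpace.inner_single_right]
    simp only [one_mul, conj_trivial]
  rw [h1, EuclideanSpace.norm_sq_eq]
  simp [Fin.sum_univ_two, h2]

lemma polar_vec (r θ : ℝ) : (!₂[r * Real.cos θ, r * Real.sin θ] : E2)
    = (r * Real.cos θ) • EuclideanSpace.single 0 1 + (r * Real.sin θ) • EuclideanSpace.single 1 1 := by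
  ext i
  fin_cases i <;> simp

lemma sqrt_bound (p : ℝ) (hp : 0 ≤ p) : |Real.sqrt (1 + p) - 1 - p / 2| ≤ |p * p| := by
  set x := Real.sqrt (1 + p) with hx
  have h1 : x ^ 2 = 1 + p := Real.sq_sqrt (by linarith)
  have h0 : 1 ≤ x := by rw [hx]; exact Real.one_le_sqrt.2 (by linarith)
  have hp' : p = x ^ 2 - 1 := by linarith
  have e : x - 1 - p / 2 = -((x - 1) ^ 2 / 2) := by rw [hp']; ring
  rw [e, abs_neg, abs_of_nonneg (by positivity), abs_of_nonneg (by positivity), hp']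
  have : (x ^ 2 - 1) * (x ^ 2 - 1) = (x - 1) ^ 2 * (x + 1) ^ 2 := by ring
  rw [this]
  nlinarith [sq_nonneg (x - 1), mul_nonneg (sq_nonneg (x - 1)) (by nlinarith : 0 ≤ (x + 1) ^ 2 - 1)]

lemma int_Ta (b₁ b₂ b₃ : ℝ) :
    ∫ θ in (-Real.pi)..Real.pi, (b₁ * Real.cos θ ^ 2 + b₂ * (Real.cos θ * Real.sin θ)
      + b₃ * Real.sin θ ^ 2) ^ 2
      = Real.pi * (3 / 4 * (b₁ ^ 2 + b₃ ^ 2) + 1 / 4 * (b₂ ^ 2 + 2 * b₁ * b₃)) := by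
  have hd : ∀ θ : ℝ, HasDerivAt (fun θ : ℝ =>
      b₁ ^ 2 * (3 / 8 * θ + Real.cos θ ^ 3 * Real.sin θ / 4 + 3 / 8 * (Real.cos θ * Real.sin θ))
      + b₃ ^ 2 * (3 / 8 * θ - Real.sin θ ^ 3 * Real.cos θ / 4 - 3 / 8 * (Real.cos θ * Real.sin θ))
      + (b₂ ^ 2 + 2 * b₁ * b₃) * (1 / 8 * θ - Real.cos θ ^ 3 * Real.sin θ / 4
        + 1 / 8 * (Real.cos θ * Real.sin θ))
      - 2 * b₁ * b₂ * (Real.cos θ ^ 4 / 4) + 2 * b₂ * b₃ * (Real.sin θ ^ 4 / 4))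
      ((b₁ * Real.cos θ ^ 2 + b₂ * (Real.cos θ * Real.sin θ)
      + b₃ * Real.sin θ ^ 2) ^ 2) θ := by
    intro θ
    have hc := Real.hasDerivAt_cos θ
    have hs := Real.hasDerivAt_sin θ
    have hi := hasDerivAt_id θ
    have c3s := ((hc.pow 3).mul hs).div_const 4
    have s3c := ((hs.pow 3).mul hc).div_const 4
    have cs := hc.mul hs
    have h := (((((((hi.const_mul (3/8)).add c3s).add (cs.const_mul (3/8))).const_mul (b₁ ^ 2)).add
      ((((hi.const_mul (3/8)).sub s3c).sub (cs.const_mul (3/8))).const_mul (b₃ ^ 2))).add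
      ((((hi.const_mul (1/8)).sub c3s).add (cs.const_mul (1/8))).const_mul (b₂ ^ 2 + 2 * b₁ * b₃))).sub
      (((hc.pow 4).div_const 4).const_mul (2 * b₁ * b₂))).add
      (((hs.pow 4).div_const 4).const_mul (2 * b₂ * b₃))
    refine h.congr_deriv ?_
    have hcs : Real.cos θ ^ 2 = 1 - Real.sin θ ^ 2 := by
      linarith [Real.sin_sq_add_cos_sq θ]
    have e3 : Real.cos θ ^ 3 = Real.cos θ * (1 - Real.sin θ ^ 2) := by rw [← hcs]; ring
    have e4 : Real.cos θ ^ 4 = (1 - Real.sin θ ^ 2) ^ 2 := by rw [← hcs]; ring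
    simp
    ring_nf
    simp only [e4, e3, hcs]
    ring
  rw [intervalIntegral.integral_eq_sub_of_hasDerivAt (fun θ _ => hd θ)
    (Continuous.intervalIntegrable (by fun_prop) _ _)]
  simp
  ring

lemma int_Tp (b₁ b₂ b₃ : ℝ) :
    ∫ θ in (-Real.pi)..Real.pi, ((2 * b₁ * Real.cos θ + b₂ * Real.sin θ) ^ 2
      + (b₂ * Real.cos θ + 2 * b₃ * Real.sin θ) ^ 2)
      = Real.pi * (4 * b₁ ^ 2 + 2 * b₂ ^ 2 + 4 * b₃ ^ 2) := by
  have hd : ∀ θ : ℝ, HasDerivAt (fun θ : ℝ =>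
      (4 * b₁ ^ 2 + b₂ ^ 2) * (θ / 2 + Real.cos θ * Real.sin θ / 2)
      + (4 * b₃ ^ 2 + b₂ ^ 2) * (θ / 2 - Real.cos θ * Real.sin θ / 2)
      + 4 * b₂ * (b₁ + b₃) * (Real.sin θ ^ 2 / 2))
      ((2 * b₁ * Real.cos θ + b₂ * Real.sin θ) ^ 2
      + (b₂ * Real.cos θ + 2 * b₃ * Real.sin θ) ^ 2) θ := by
    intro θ
    have hc := Real.hasDerivAt_cos θ
    have hs := Real.hasDerivAt_sin θ
    have hi := hasDerivAt_id θ
    have cs := (hc.mul hs).div_const 2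
    have h := ((((hi.div_const 2).add cs).const_mul (4 * b₁ ^ 2 + b₂ ^ 2)).add
      (((hi.div_const 2).sub cs).const_mul (4 * b₃ ^ 2 + b₂ ^ 2))).add
      (((hs.pow 2).div_const 2).const_mul (4 * b₂ * (b₁ + b₃)))
    refine h.congr_deriv ?_
    have hcs : Real.cos θ ^ 2 = 1 - Real.sin θ ^ 2 := by
      linarith [Real.sin_sq_add_cos_sq θ]
    simp
    ring_nf
    simp only [hcs]
    ring
  rw [intervalIntegral.integral_eq_sub_of_hasDerivAt (fun θ _ => hd θ)
    (Continuous.intervalIntegrable (by fun_prop) _ _)]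
  simp
  ring

lemma integrand_eq (x y : ℝ) (hx : 0 < x) (s : ℂ) :
    ((x ^ 2 + y ^ 2 : ℝ) : ℂ) ^ (s / 2)
      = (x : ℂ) ^ s * ((1 + y ^ 2 / x ^ 2 : ℝ) : ℂ) ^ (s / 2) := by
  have h1 : ∀ (t : ℝ) (z : ℂ), 0 < t → (t : ℂ) ^ z = exp ((Real.log t : ℂ) * z) := by
    intro t z ht
    rw [cpow_def_of_ne_zero (by exact_mod_cast ht.ne'), ofReal_log ht.le]
  have hp : 0 < 1 + y ^ 2 / x ^ 2 := by positivity
  have e : x ^ 2 + y ^ 2 = x ^ 2 * (1 + y ^ 2 / x ^ 2) := by field_simp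
  rw [h1 _ _ (by positivity), h1 _ _ hx, h1 _ _ hp, ← exp_add, e,
    Real.log_mul (by positivity) hp.ne', Real.log_pow]
  congr 1
  push_cast
  ring

/-- Theorem 4.1, residue at `s = -4`: for a surface in `ℝ³` given locally
as the graph of a smooth `f : ℝ² → ℝ` with `f(0) = 0`, `∇f(0) = 0`, the localized
pointwise Brylinski beta function
`B(s) = ∫_{ℝ²} (‖w‖² + f(w)²)^(s/2) ψ(w) √(1 + ‖∇f(w)‖²) dw`
admits an analytic continuation `F` to `{Re s > -5} \ {-2, -4}` such that
`(s + 4)·F(s) → (π/2)(b₁² + b₂² + b₃² - 2b₁b₃)` as `s → -4`, where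
`b₁ = (1/2)∂²f/∂x²(0)`, `b₂ = ∂²f/∂x∂y(0)`, `b₃ = (1/2)∂²f/∂y²(0)`. -/
theorem brylinski_beta_surface_residue_neg_four
    (f : EuclideanSpace ℝ (Fin 2) → ℝ)
    (hf : ContDiff ℝ (⊤ : ℕ∞) f) (hf0 : f 0 = 0) (hgrad : gradient f 0 = 0)
    (ψ : EuclideanSpace ℝ (Fin 2) → ℝ)
    (hψ : ContDiff ℝ (⊤ : ℕ∞) ψ) (hψc : HasCompactSupport ψ)
    (hψ1 : ∀ᶠ w in nhds (0 : EuclideanSpace ℝ (Fin 2)), ψ w = 1)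
    (b₁ b₂ b₃ : ℝ)
    (hb₁ : b₁ = (1 / 2) * iteratedFDeriv ℝ 2 f 0
      ![EuclideanSpace.single 0 1, EuclideanSpace.single 0 1])
    (hb₂ : b₂ = iteratedFDeriv ℝ 2 f 0
      ![EuclideanSpace.single 0 1, EuclideanSpace.single 1 1])
    (hb₃ : b₃ = (1 / 2) * iteratedFDeriv ℝ 2 f 0
      ![EuclideanSpace.single 1 1, EuclideanSpace.single 1 1]) :
    ∃ F : ℂ → ℂ,
      (∀ s : ℂ, -2 < s.re →
        F s = ∫ w : EuclideanSpace ℝ (Fin 2),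
          (((‖w‖ ^ 2 + (f w) ^ 2 : ℝ) : ℂ) ^ (s / 2)) * (ψ w : ℂ)
            * ((Real.sqrt (1 + ‖gradient f w‖ ^ 2) : ℝ) : ℂ)) ∧
      (∀ s : ℂ, -5 < s.re → s ≠ -2 → s ≠ -4 → DifferentiableAt ℂ F s) ∧
      Tendsto (fun s : ℂ => (s + 4) * F s) (nhdsWithin (-4 : ℂ) {(-4 : ℂ)}ᶜ)
        (nhds (((Real.pi / 2) * (b₁ ^ 2 + b₂ ^ 2 + b₃ ^ 2 - 2 * b₁ * b₃) : ℝ) : ℂ)) := by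
  have hfd0 : fderiv ℝ f 0 = 0 := by
    have : (InnerProductSpace.toDual ℝ E2).symm (fderiv ℝ f 0) = 0 := hgrad
    simpa using this
  have hgn : ∀ w, ‖gradient f w‖ = ‖fderiv ℝ f w‖ := by
    intro w
    simp [gradient]
  have h1 : ContDiff ℝ (⊤ : ℕ∞) (fderiv ℝ f) := hf.fderiv_right (by simp)
  have hfc : Continuous f := hf.continuous
  have hψcont : Continuous ψ := hψ.continuous
  have hf1c : Continuous (fderiv ℝ f) := h1.continuous
  -- the radius
  obtain ⟨R, hR, hRψ⟩ : ∃ R : ℝ, 1 ≤ R ∧ ∀ w, R ≤ ‖w‖ → ψ w = 0 := by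
    obtain ⟨R0, hR0⟩ := hψc.isCompact.isBounded.subset_closedBall (0 : E2)
    refine ⟨max 1 (R0 + 1), le_max_left _ _, fun w hw => ?_⟩
    by_contra hne
    have := hR0 (subset_tsupport ψ hne)
    rw [mem_closedBall_zero_iff] at this
    have := (le_max_right 1 (R0 + 1)).trans hw
    linarith
  have hR0 : 0 ≤ R := by linarith
  obtain ⟨C, hC, hT1, hT2⟩ := taylor_f f hf hf0 hfd0 R
  set D := fderiv ℝ (fderiv ℝ f) 0 with hD
  have hsymm : ∀ v w, D v w = D w v := by
    have := (hf.contDiffAt (x := 0)).isSymmSndFDerivAt (by simp; exact WithTop.coe_le_coe.2 (le_top : (2 : ℕ∞) ≤ ⊤))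
    intro v w
    exact this.eq v w
  set q : E2 → ℝ := fun w => (1 / 2) * D w w with hq
  set nf : E2 → ℝ := fun w => ‖fderiv ℝ f w‖ with hnf
  set n0 : E2 → ℝ := fun w => ‖D w‖ with hn0
  have hqc : Continuous q := by
    have : Continuous fun w => D w w := D.continuous.clm_apply continuous_id
    exact continuous_const.mul this
  have hnfc : Continuous nf := hf1c.norm
  have hn0c : Continuous n0 := D.continuous.norm
  have Bfq : BO R 3 (fun w => f w - q w) := ⟨C, hC, hT2⟩
  have Bq : BO R 2 q := by
    refine ⟨‖D‖, by positivity, fun w _ => ?_⟩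
    have := D.le_opNorm₂ w w
    rw [Real.norm_eq_abs] at this
    rw [hq]
    dsimp only
    rw [abs_mul, abs_of_pos (by norm_num : (0:ℝ) < 1 / 2)]
    nlinarith [abs_nonneg (D w w)]
  have Bf : BO R 2 f := ((Bfq.mono (by norm_num) hR0).add Bq).congr (fun w => by ring)
  have Bn0 : BO R 1 n0 := by
    refine ⟨‖D‖, by positivity, fun w _ => ?_⟩
    rw [hn0]
    dsimp only
    rw [abs_norm, pow_one]
    exact D.le_opNorm w
  have Bnn : BO R 2 (fun w => nf w - n0 w) :=
    ⟨C, hC, fun w hw => (abs_norm_sub_norm_le _ _).trans (hT1 w hw)⟩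
  have Bnf : BO R 1 nf := ((Bnn.mono (by norm_num) hR0).add Bn0).congr (fun w => by ring)
  -- the abstract data
  set a : E2 → ℝ := fun w => f w ^ 2 / ‖w‖ ^ 2 with ha
  set a0 : E2 → ℝ := fun w => q w ^ 2 / ‖w‖ ^ 2 with ha0
  set p0 : E2 → ℝ := fun w => n0 w ^ 2 with hp0
  set J : E2 → ℝ := fun w => Real.sqrt (1 + nf w ^ 2) with hJ
  set u : E2 → ℝ := fun w => ψ w * J w with hu
  have hJc : Continuous J := by
    rw [hJ]
    fun_prop
  have Ba : BO R 2 a := by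
    have : BO R (2 + 2) (fun w => f w ^ 2) := (Bf.mul Bf).congr (fun w => by ring)
    exact this.div_sq
  have Ba0 : BO R 2 a0 := by
    have : BO R (2 + 2) (fun w => q w ^ 2) := (Bq.mul Bq).congr (fun w => by ring)
    exact this.div_sq
  have Baa : BO R 3 (fun w => a w - a0 w) := by
    have : BO R (3 + 2) (fun w => f w ^ 2 - q w ^ 2) :=
      (Bfq.mul (Bf.add Bq)).congr (fun w => by ring)
    exact this.div_sq.congr (fun w => by simp only [ha, ha0]; ring)
  have Bp0 : BO R 2 p0 := (Bn0.mul Bn0).congr (fun w => by simp only [hp0]; ring)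
  have Bp : BO R 2 (fun w => nf w ^ 2) := (Bnf.mul Bnf).congr (fun w => by ring)
  have Bpp : BO R 3 (fun w => nf w ^ 2 - p0 w) :=
    (Bnn.mul (Bnf.add Bn0)).congr (fun w => by simp only [hp0]; ring)
  have BJ0 : BO R 3 (fun w => J w - 1 - nf w ^ 2 / 2) :=
    ((Bp.mul Bp).mono (by norm_num) hR0).of_abs_le (fun w => sqrt_bound _ (sq_nonneg _))
  have BJ : BO R 3 (fun w => J w - 1 - p0 w / 2) :=
    (BJ0.add (Bpp.const_mul (1 / 2))).congr (fun w => by ring)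
  have BJc : BO R 0 J := BO.of_continuous hJc
  have Bψ : BO R 0 ψ := BO.of_continuous hψcont
  have Bψχ : BO R 3 (fun w => ψ w - chi w) := by
    refine BO_of_eventually_zero ((Bψ.add (BO_chi.const_mul (-1))).congr (fun w => by ring)) ?_
    filter_upwards [hψ1, Metric.ball_mem_nhds (0 : E2) one_pos] with w hw hw1
    rw [hw, chi, Set.indicator_of_mem hw1, sub_self]
  have Bu : BO R 0 u := Bψ.mul BJc
  have Bu3 : BO R 3 (fun w => u w - chi w * (1 + p0 w / 2)) :=
    (BO.add (Bψχ.mul BJc) (by simpa using BO_chi.mul BJ)).congr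
      (fun w => by simp only [hu]; ring)
  have Bχp : BO R 2 (fun w => chi w * p0 w) := by simpa using BO_chi.mul Bp0
  have Buχ : BO R 2 (fun w => u w - chi w) :=
    ((Bu3.mono (by norm_num) hR0).add (Bχp.const_mul (1 / 2))).congr (fun w => by ring)
  have Bau : BO R 3 (fun w => a w * u w - chi w * a0 w) :=
    (((Ba.mul Buχ).mono (by norm_num) hR0).add
      (show BO R 3 (fun w => chi w * (a w - a0 w)) by simpa using BO_chi.mul Baa)).congr
      (fun w => by ring)
  -- polar values
  have d00 : D (EuclideanSpace.single 0 1) (EuclideanSpace.single 0 1) = 2 * b₁ := by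
    rw [hb₁, iteratedFDeriv_two_apply]; simp [hD]
  have d01 : D (EuclideanSpace.single 0 1) (EuclideanSpace.single 1 1) = b₂ := by
    rw [hb₂, iteratedFDeriv_two_apply]; simp [hD]
  have d10 : D (EuclideanSpace.single 1 1) (EuclideanSpace.single 0 1) = b₂ := by
    rw [hsymm, d01]
  have d11 : D (EuclideanSpace.single 1 1) (EuclideanSpace.single 1 1) = 2 * b₃ := by
    rw [hb₃, iteratedFDeriv_two_apply]; simp [hD]
  have hTa : ∀ r θ : ℝ, 0 < r → a0 !₂[r * Real.cos θ, r * Real.sin θ]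
      = r ^ 2 * (b₁ * Real.cos θ ^ 2 + b₂ * (Real.cos θ * Real.sin θ)
        + b₃ * Real.sin θ ^ 2) ^ 2 := by
    intro r θ hr
    have hn : ‖(!₂[r * Real.cos θ, r * Real.sin θ] : E2)‖ ^ 2 = r ^ 2 := by
      rw [EuclideanSpace.norm_sq_eq]
      simp [Fin.sum_univ_two]
      nlinarith [Real.sin_sq_add_cos_sq θ]
    have hqv : q !₂[r * Real.cos θ, r * Real.sin θ] = r ^ 2 *
        (b₁ * Real.cos θ ^ 2 + b₂ * (Real.cos θ * Real.sin θ) + b₃ * Real.sin θ ^ 2) := by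
      simp only [hq]
      rw [polar_vec]
      simp only [map_add, map_smul, add_apply, smul_apply,
        smul_eq_mul, d00, d01, d10, d11]
      ring
    simp only [ha0]
    rw [hqv, hn]
    field_simp
  have hTp : ∀ r θ : ℝ, 0 < r → p0 !₂[r * Real.cos θ, r * Real.sin θ]
      = r ^ 2 * ((2 * b₁ * Real.cos θ + b₂ * Real.sin θ) ^ 2
      + (b₂ * Real.cos θ + 2 * b₃ * Real.sin θ) ^ 2) := by
    intro r θ hr
    simp only [hp0, hn0]
    rw [norm_sq_dual, polar_vec]
    simp only [map_add, map_smul, add_apply, smul_apply,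
        smul_eq_mul, d00, d01, d10, d11]
    ring
  obtain ⟨F, hF1, hF2, hF3⟩ := abstract_cont hR a u a0 p0 (fun w => by simp only [ha]; positivity)
    (by simp only [ha]; exact (hfc.measurable.pow_const 2).div (measurable_norm.pow_const 2))
    (by simp only [hu]; exact (hψcont.mul hJc).measurable)
    (by simp only [ha0]; exact (hqc.measurable.pow_const 2).div (measurable_norm.pow_const 2))
    (by simp only [hp0]; exact (hn0c.pow 2).measurable)
    Ba Bu Ba0 Bp0 Bu3 Bau (fun w hw => by simp only [hu, hRψ w hw, zero_mul]) _ _ _ _ hTa hTp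
    (int_Ta b₁ b₂ b₃) (int_Tp b₁ b₂ b₃)
  refine ⟨F, ?_, hF2, ?_⟩
  · intro s hs
    rw [hF1 s hs]
    refine integral_congr_ae ?_
    filter_upwards [ae_ne_zero_E2] with w hw
    rw [integrand_eq _ _ (norm_pos_iff.2 hw), hgn]
    simp only [ha, hu, hJ, hnf]
    push_cast
    ring
  · convert hF3 using 3
    ring
end
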